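/- arXiv:2106.08666 — 3 statements merged into one kernel-verified Lean document; each statement's English description precedes it below -/
import Mathlib

section
/- Let Q be a quiver whose underlying graph is the Dynkin diagram A_n, and let L, E be indecomposable finite-dimensional complex representations of Q. Then dim Hom(L,E) ≤ 1 and dim Ext¹(L,E) ≤ 1. -/
/-!  Representations of a quiver of type `A_{n+1}`:  vertices `Fin (n+1)`, edges `Fin n`,
where the edge `i` joins the vertices `i` and `i+1` and the orientation function
`o : Fin n → Bool` orients it from `i` to `i+1` (if `o i = true`) or from `i+1` to `i`
(if `o i = false`). -/

/-- Source of the `i`-th arrow. -/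
def ASrc {n : ℕ} (o : Fin n → Bool) (i : Fin n) : Fin (n + 1) :=
  if o i then i.castSucc else i.succ

/-- Target of the `i`-th arrow. -/
def ATgt {n : ℕ} (o : Fin n → Bool) (i : Fin n) : Fin (n + 1) :=
  if o i then i.succ else i.castSucc

/-- A finite-dimensional complex representation of the `A_{n+1}` quiver with orientation `o`. -/
structure ARep (n : ℕ) (o : Fin n → Bool) where
  M : Fin (n + 1) → Type
  [addCommGroup : ∀ v, AddCommGroup (M v)]
  [module : ∀ v, Module ℂ (M v)]
  [finite : ∀ v, FiniteDimensional ℂ (M v)]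
  f : ∀ i : Fin n, M (ASrc o i) →ₗ[ℂ] M (ATgt o i)

attribute [instance] ARep.addCommGroup ARep.module ARep.finite

namespace ARep

variable {n : ℕ} {o : Fin n → Bool}

/-- The space of morphisms `X → Y` of representations, as a submodule of
`∀ v, X.M v →ₗ Y.M v`. -/
def HomSub (X Y : ARep n o) : Submodule ℂ (∀ v, X.M v →ₗ[ℂ] Y.M v) where
  carrier := {h | ∀ i : Fin n, (h (ATgt o i)).comp (X.f i) = (Y.f i).comp (h (ASrc o i))}
  add_mem' := by
    intro a b ha hb i
    simp only [Pi.add_apply, LinearMap.add_comp, LinearMap.comp_add, ha i, hb i]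
  zero_mem' := by
    intro i
    simp
  smul_mem' := by
    intro c a ha i
    simp only [Pi.smul_apply, LinearMap.smul_comp, LinearMap.comp_smul, ha i]

/-- The differential of the standard 2-term complex computing `Hom` (kernel) and `Ext¹`
(cokernel) over the hereditary path algebra. -/
noncomputable def extMap (X Y : ARep n o) :
    (∀ v, X.M v →ₗ[ℂ] Y.M v) →ₗ[ℂ] (∀ i : Fin n, X.M (ASrc o i) →ₗ[ℂ] Y.M (ATgt o i)) where
  toFun h := fun i => (Y.f i).comp (h (ASrc o i)) - (h (ATgt o i)).comp (X.f i)
  map_add' a b := by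
    funext i
    simp only [Pi.add_apply, LinearMap.comp_add, LinearMap.add_comp]
    abel
  map_smul' c a := by
    funext i
    simp only [Pi.smul_apply, LinearMap.comp_smul, LinearMap.smul_comp, smul_sub,
      RingHom.id_apply]

/-- `dim Hom(X,Y)`. -/
noncomputable def dimHom (X Y : ARep n o) : ℕ :=
  Module.finrank ℂ (HomSub X Y)

/-- `dim Ext¹(X,Y)`. -/
noncomputable def dimExt (X Y : ARep n o) : ℕ :=
  Module.finrank ℂ
    ((∀ i : Fin n, X.M (ASrc o i) →ₗ[ℂ] Y.M (ATgt o i)) ⧸ LinearMap.range (extMap X Y))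

/-- A representation is indecomposable iff it is nonzero and its only idempotent
endomorphisms are `0` and the identity. -/
def Indecomposable (X : ARep n o) : Prop :=
  (∃ v, ∃ x : X.M v, x ≠ 0) ∧
  ∀ e : ∀ v, X.M v →ₗ[ℂ] X.M v, e ∈ HomSub X X → (∀ v, (e v).comp (e v) = e v) →
    e = 0 ∨ e = fun _ => LinearMap.id

end ARep

namespace ARep

variable {n : ℕ} {o : Fin n → Bool}

theorem src_of_true {i : Fin n} (h : o i = true) : ASrc o i = i.castSucc := by simp [ASrc, h]
theorem tgt_of_true {i : Fin n} (h : o i = true) : ATgt o i = i.succ := by simp [ATgt, h]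
theorem src_of_false {i : Fin n} (h : o i = false) : ASrc o i = i.succ := by simp [ASrc, h]
theorem tgt_of_false {i : Fin n} (h : o i = false) : ATgt o i = i.castSucc := by simp [ATgt, h]

theorem src_or (o : Fin n → Bool) (i : Fin n) :
    (ASrc o i = i.castSucc ∧ ATgt o i = i.succ) ∨ (ASrc o i = i.succ ∧ ATgt o i = i.castSucc) := by
  cases h : o i
  · exact Or.inr ⟨src_of_false h, tgt_of_false h⟩
  · exact Or.inl ⟨src_of_true h, tgt_of_true h⟩

theorem src_le (o : Fin n → Bool) (i : Fin n) : ASrc o i ≤ i.succ := by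
  rcases src_or o i with h | h <;> rw [h.1]
  exact Fin.castSucc_lt_succ.le

theorem tgt_le (o : Fin n → Bool) (i : Fin n) : ATgt o i ≤ i.succ := by
  rcases src_or o i with h | h <;> rw [h.2]
  exact Fin.castSucc_lt_succ.le

theorem le_src (o : Fin n → Bool) (i : Fin n) : i.castSucc ≤ ASrc o i := by
  rcases src_or o i with h | h <;> rw [h.1]
  exact Fin.castSucc_lt_succ.le

theorem le_tgt (o : Fin n → Bool) (i : Fin n) : i.castSucc ≤ ATgt o i := by
  rcases src_or o i with h | h <;> rw [h.2]
  exact Fin.castSucc_lt_succ.le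

theorem src_ne_tgt (o : Fin n → Bool) (i : Fin n) : ASrc o i ≠ ATgt o i := by
  rcases src_or o i with h | h <;> rw [h.1, h.2]
  · exact Fin.castSucc_lt_succ.ne
  · exact Fin.castSucc_lt_succ.ne'

/-! ### Linear algebra steps -/

/-- `(x, ξ)` defines a rank one idempotent compatible with the family of subspaces. -/
def Good {V : Type} [AddCommGroup V] [Module ℂ V] (F : Set (Submodule ℂ V)) (x : V)
    (ξ : V →ₗ[ℂ] ℂ) : Prop :=
  ξ x = 1 ∧ ∀ U ∈ F, x ∈ U ∨ ∀ y ∈ U, ξ y = 0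

theorem step_fwd {V W : Type} [AddCommGroup V] [Module ℂ V] [FiniteDimensional ℂ V]
    [AddCommGroup W] [Module ℂ W] (f : V →ₗ[ℂ] W)
    (F : Set (Submodule ℂ V)) (hF : IsChain (· ≤ ·) F) (x' : W) (ξ' : W →ₗ[ℂ] ℂ)
    (h : Good (Submodule.map f '' (insert ⊤ F)) x' ξ') :
    ξ' ∘ₗ f = 0 ∨ ∃ x ξ, Good F x ξ ∧ f x = x' ∧ ξ' ∘ₗ f = ξ := by
  obtain ⟨h1, h2⟩ := h
  have hF' : IsChain (· ≤ ·) (insert ⊤ F) := hF.insert fun b _ _ => Or.inr le_top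
  by_cases hx : x' ∈ Submodule.map f ⊤
  · right
    obtain ⟨U, ⟨hU, hxU⟩, hmin⟩ := WellFounded.has_min (wellFounded_lt (α := Submodule ℂ V))
      {U | U ∈ insert ⊤ F ∧ x' ∈ Submodule.map f U} ⟨⊤, by simp, hx⟩
    obtain ⟨x, hxU', rfl⟩ := hxU
    refine ⟨x, _, ⟨h1, fun G hG => ?_⟩, rfl, rfl⟩
    by_cases hUG : U ≤ G
    · exact Or.inl (hUG hxU')
    · right
      have hGU : G < U := by
        rcases hF'.total hU (Set.mem_insert_of_mem _ hG) with h | h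
        · exact absurd h hUG
        · exact lt_of_le_not_ge h hUG
      have hn : f x ∉ Submodule.map f G := fun hm =>
        hmin G ⟨Set.mem_insert_of_mem _ hG, hm⟩ hGU
      intro y hy
      rcases h2 _ ⟨G, Set.mem_insert_of_mem _ hG, rfl⟩ with h | h
      · exact absurd h hn
      · exact h _ (Submodule.mem_map_of_mem hy)
  · left
    rcases h2 _ ⟨⊤, Set.mem_insert _ _, rfl⟩ with h | h
    · exact absurd h hx
    · ext y
      exact h _ (Submodule.mem_map_of_mem trivial)

theorem chain_fwd {V W : Type} [AddCommGroup V] [Module ℂ V]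
    [AddCommGroup W] [Module ℂ W] (f : V →ₗ[ℂ] W)
    (F : Set (Submodule ℂ V)) (hF : IsChain (· ≤ ·) F) :
    IsChain (· ≤ ·) (Submodule.map f '' (insert ⊤ F)) := by
  have hF' : IsChain (· ≤ ·) (insert ⊤ F) := hF.insert fun b _ _ => Or.inr le_top
  rintro _ ⟨A, hA, rfl⟩ _ ⟨B, hB, rfl⟩ -
  rcases hF'.total hA hB with h | h
  · exact Or.inl (Submodule.map_mono h)
  · exact Or.inr (Submodule.map_mono h)

theorem chain_bwd {V W : Type} [AddCommGroup V] [Module ℂ V]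
    [AddCommGroup W] [Module ℂ W] (f : W →ₗ[ℂ] V)
    (F : Set (Submodule ℂ V)) (hF : IsChain (· ≤ ·) F) :
    IsChain (· ≤ ·) (Submodule.comap f '' (insert ⊥ F)) := by
  have hF' : IsChain (· ≤ ·) (insert ⊥ F) := hF.insert fun b _ _ => Or.inl bot_le
  rintro _ ⟨A, hA, rfl⟩ _ ⟨B, hB, rfl⟩ -
  rcases hF'.total hA hB with h | h
  · exact Or.inl (Submodule.comap_mono h)
  · exact Or.inr (Submodule.comap_mono h)

theorem step_bwd {V W : Type} [AddCommGroup V] [Module ℂ V] [FiniteDimensional ℂ V]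
    [AddCommGroup W] [Module ℂ W] (f : W →ₗ[ℂ] V)
    (F : Set (Submodule ℂ V)) (hF : IsChain (· ≤ ·) F) (x' : W) (ξ' : W →ₗ[ℂ] ℂ)
    (h : Good (Submodule.comap f '' (insert ⊥ F)) x' ξ') :
    f x' = 0 ∨ ∃ x ξ, Good F x ξ ∧ f x' = x ∧ ξ ∘ₗ f = ξ' := by
  obtain ⟨h1, h2⟩ := h
  have hF' : IsChain (· ≤ ·) (insert ⊥ F) := hF.insert fun b _ _ => Or.inl bot_le
  by_cases hx : f x' = 0
  · exact Or.inl hx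
  · right
    obtain ⟨U, ⟨hU, hxU⟩, hmax⟩ := WellFounded.has_min (wellFounded_gt (α := Submodule ℂ V))
      {U | U ∈ insert ⊥ F ∧ f x' ∉ U} ⟨⊥, by simp, by simpa using hx⟩
    have hk : ∀ y, f y ∈ U → ξ' y = 0 := by
      rcases h2 _ ⟨U, hU, rfl⟩ with h | h
      · exact absurd h hxU
      · exact h
    let g : W →ₗ[ℂ] V ⧸ U := U.mkQ ∘ₗ f
    have hg : LinearMap.ker g ≤ LinearMap.ker ξ' := by
      intro y hy
      apply hk
      simpa [g] using hy
    obtain ⟨η, hη⟩ : ∃ η : (V ⧸ U) →ₗ[ℂ] ℂ, η ∘ₗ g = ξ' := by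
      obtain ⟨r, hr⟩ := LinearMap.exists_leftInverse_of_injective
        ((LinearMap.ker g).liftQ g le_rfl) (Submodule.ker_liftQ_eq_bot _ _ _ le_rfl)
      refine ⟨((LinearMap.ker g).liftQ ξ' hg) ∘ₗ r, ?_⟩
      ext y
      have := LinearMap.congr_fun hr (Submodule.Quotient.mk y)
      simp only [LinearMap.comp_apply, Submodule.liftQ_apply, LinearMap.id_apply] at this ⊢
      rw [this, Submodule.liftQ_apply]
    refine ⟨f x', η ∘ₗ U.mkQ, ⟨?_, fun G hG => ?_⟩, rfl, hη⟩
    · rw [← h1, ← hη]; rfl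
    · by_cases hxG : f x' ∈ G
      · exact Or.inl hxG
      · right
        have hGU : G ≤ U := by
          rcases hF'.total hU (Set.mem_insert_of_mem _ hG) with h | h
          · by_contra hc
            exact hmax G ⟨Set.mem_insert_of_mem _ hG, hxG⟩ (lt_of_le_not_ge h hc)
          · exact h
        intro y hy
        have : U.mkQ y = 0 := by simpa using hGU hy
        rw [LinearMap.comp_apply, this, map_zero]

theorem exists_good {V : Type} [AddCommGroup V] [Module ℂ V] [FiniteDimensional ℂ V]
    [Nontrivial V] (F : Set (Submodule ℂ V)) (hF : IsChain (· ≤ ·) F) :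
    ∃ x ξ, Good F x ξ := by
  have hF' : IsChain (· ≤ ·) (insert ⊤ F) := hF.insert fun b _ _ => Or.inr le_top
  obtain ⟨U, ⟨hU, hxU⟩, hmin⟩ := WellFounded.has_min (wellFounded_lt (α := Submodule ℂ V))
      {U | U ∈ insert ⊤ F ∧ U ≠ ⊥} ⟨⊤, by simp, top_ne_bot⟩
  obtain ⟨x, hx, hx0⟩ := Submodule.exists_mem_ne_zero_of_ne_bot hxU
  obtain ⟨ξ, hξ⟩ : ∃ ξ : V →ₗ[ℂ] ℂ, ξ x = 1 := by
    obtain ⟨r, hr⟩ := LinearMap.exists_leftInverse_of_injective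
      (LinearMap.toSpanSingleton ℂ V x) (LinearMap.ker_toSpanSingleton ℂ hx0)
    exact ⟨r, by simpa using LinearMap.congr_fun hr 1⟩
  refine ⟨x, ξ, hξ, fun G hG => ?_⟩
  rcases hF'.total hU (Set.mem_insert_of_mem _ hG) with h | h
  · exact Or.inl (h hx)
  · by_cases hUG : U ≤ G
    · exact Or.inl (hUG hx)
    · right
      have : G = ⊥ := by
        by_contra hne
        exact hmin G ⟨Set.mem_insert_of_mem _ hG, hne⟩ (lt_of_le_not_ge h hUG)
      subst this
      intro y hy
      rw [(Submodule.mem_bot ℂ).1 hy, map_zero]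

/-! ### Lifting rank one idempotents -/

/-- Commutation of a family of endomorphisms with the `i`-th arrow. -/
def Comm (X : ARep n o) (e : ∀ w, X.M w →ₗ[ℂ] X.M w) (i : Fin n) : Prop :=
  (e (ATgt o i)).comp (X.f i) = (X.f i).comp (e (ASrc o i))

/-- A family of idempotents of rank at most one, on the vertices up to `v`. -/
def Partial (X : ARep n o) (v : Fin (n + 1)) (e : ∀ w, X.M w →ₗ[ℂ] X.M w) : Prop :=
  (∀ w, v < w → e w = 0) ∧ (∀ w, (e w).comp (e w) = e w) ∧
    (∀ w, ∃ x : X.M w, ∃ ξ : X.M w →ₗ[ℂ] ℂ, e w = ξ.smulRight x) ∧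
    ∀ i : Fin n, i.succ ≤ v → Comm X e i

def Lift (X : ARep n o) (v : Fin (n + 1)) : Prop :=
  ∃ F : Set (Submodule ℂ (X.M v)), IsChain (· ≤ ·) F ∧ ∀ x ξ, Good F x ξ →
    ∃ e, Partial X v e ∧ e v = ξ.smulRight x

theorem smulRight_idem {V : Type} [AddCommGroup V] [Module ℂ V] (x : V) (ξ : V →ₗ[ℂ] ℂ)
    (h : ξ x = 1) : (ξ.smulRight x).comp (ξ.smulRight x) = ξ.smulRight x := by
  ext y; simp [h]

theorem partial_zero (X : ARep n o) (v : Fin (n + 1)) : Partial X v 0 :=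
  ⟨fun _ _ => rfl, fun _ => by simp, fun w => ⟨0, 0, by simp⟩, fun i _ => by simp [Comm]⟩

theorem partial_update (X : ARep n o) (i : Fin n) (v : Fin (n + 1)) (hv : v = i.succ)
    (e : ∀ w, X.M w →ₗ[ℂ] X.M w)
    (he : Partial X i.castSucc e) (x : X.M v) (ξ : X.M v →ₗ[ℂ] ℂ) (h : ξ x = 1)
    (hc : Comm X (Function.update e v (ξ.smulRight x)) i) :
    Partial X v (Function.update e v (ξ.smulRight x)) := by
  obtain ⟨h1, h2, h3, h4⟩ := he
  refine ⟨fun w hw => ?_, fun w => ?_, fun w => ?_, fun j hj => ?_⟩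
  · rw [Function.update_of_ne hw.ne']
    apply h1
    rw [hv] at hw
    exact Fin.castSucc_lt_succ.trans hw
  · by_cases hw : w = v
    · subst hw
      rw [Function.update_self]
      exact smulRight_idem x ξ h
    · rw [Function.update_of_ne hw]; exact h2 w
  · by_cases hw : w = v
    · subst hw
      exact ⟨x, ξ, by rw [Function.update_self]⟩
    · rw [Function.update_of_ne hw]; exact h3 w
  · by_cases hji : j = i
    · subst hji; exact hc
    · subst hv
      have hlt : j.succ ≤ i.castSucc := by
        simp only [Fin.le_def, Fin.val_succ, Fin.val_castSucc] at hj ⊢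
        have : (j : ℕ) ≠ i := fun h => hji (Fin.ext h)
        omega
      have hlt' : j.succ < i.succ := lt_of_le_of_lt hlt Fin.castSucc_lt_succ
      unfold Comm
      rw [Function.update_of_ne (lt_of_le_of_lt (src_le o j) hlt').ne,
        Function.update_of_ne (lt_of_le_of_lt (tgt_le o j) hlt').ne]
      exact h4 j hlt

theorem lift_all (X : ARep n o) (v : Fin (n + 1)) : Lift X v := by
  induction v using Fin.induction with
  | zero =>
    refine ⟨∅, by simp, fun x ξ hg => ⟨Function.update 0 0 (ξ.smulRight x), ⟨?_, ?_, ?_, ?_⟩,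
      by rw [Function.update_self]⟩⟩
    · intro w hw
      rw [Function.update_of_ne hw.ne']; rfl
    · intro w
      by_cases hw : w = 0
      · subst hw; rw [Function.update_self]; exact smulRight_idem x ξ hg.1
      · rw [Function.update_of_ne hw]; simp
    · intro w
      by_cases hw : w = 0
      · subst hw; exact ⟨x, ξ, by rw [Function.update_self]⟩
      · rw [Function.update_of_ne hw]; exact ⟨0, 0, by simp⟩
    · intro i hi
      exact absurd hi (by simp)
  | succ i ih =>
    rcases src_or o i with ⟨hs, ht⟩ | ⟨hs, ht⟩
    · rw [← hs] at ih
      rw [← ht]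
      obtain ⟨F, hF, hl⟩ := ih
      refine ⟨_, chain_fwd (X.f i) F hF, fun x' ξ' hg => ?_⟩
      rcases step_fwd (X.f i) F hF x' ξ' hg with h0 | ⟨x, ξ, hgd, hx, hξ⟩
      · refine ⟨_, partial_update X i _ ht 0 (partial_zero X _) x' ξ' hg.1 ?_,
          by rw [Function.update_self]⟩
        unfold Comm
        rw [Function.update_self, Function.update_of_ne (src_ne_tgt o i)]
        ext y
        have := LinearMap.congr_fun h0 y
        simp only [LinearMap.comp_apply, LinearMap.zero_apply] at this
        simp [this]
      · obtain ⟨e, he, hev⟩ := hl x ξ hgd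
        rw [hs] at he
        refine ⟨_, partial_update X i _ ht e he x' ξ' hg.1 ?_, by rw [Function.update_self]⟩
        unfold Comm
        rw [Function.update_self, Function.update_of_ne (src_ne_tgt o i), hev]
        ext y
        simp [← hξ, hx]
    · rw [← ht] at ih
      rw [← hs]
      obtain ⟨F, hF, hl⟩ := ih
      refine ⟨_, chain_bwd (X.f i) F hF, fun x' ξ' hg => ?_⟩
      rcases step_bwd (X.f i) F hF x' ξ' hg with h0 | ⟨x, ξ, hgd, hx, hξ⟩
      · refine ⟨_, partial_update X i _ hs 0 (partial_zero X _) x' ξ' hg.1 ?_,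
          by rw [Function.update_self]⟩
        unfold Comm
        rw [Function.update_self, Function.update_of_ne (src_ne_tgt o i).symm]
        ext y
        simp [h0]
      · obtain ⟨e, he, hev⟩ := hl x ξ hgd
        rw [ht] at he
        refine ⟨_, partial_update X i _ hs e he x' ξ' hg.1 ?_, by rw [Function.update_self]⟩
        unfold Comm
        rw [Function.update_self, Function.update_of_ne (src_ne_tgt o i).symm, hev]
        ext y
        simp [← hξ, hx]

/-! ### Structure of indecomposables -/

theorem Indecomposable.finrank_le {X : ARep n o} (hX : X.Indecomposable) (v : Fin (n + 1)) :
    Module.finrank ℂ (X.M v) ≤ 1 := by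
  obtain ⟨⟨v0, x0, hx0⟩, hidem⟩ := hX
  obtain ⟨m, hm, hmax⟩ := WellFounded.has_min (wellFounded_gt (α := Fin (n + 1)))
    {w | Nontrivial (X.M w)} ⟨v0, ⟨x0, 0, hx0⟩⟩
  have hm' : Nontrivial (X.M m) := hm
  obtain ⟨F, hF, hl⟩ := lift_all X m
  obtain ⟨x, ξ, hg⟩ := exists_good F hF
  obtain ⟨e, ⟨-, h2, h3, h4⟩, hem⟩ := hl x ξ hg
  have hsub : ∀ w, m < w → Subsingleton (X.M w) := fun w hw =>
    not_nontrivial_iff_subsingleton.1 fun h => hmax w h hw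
  have hmem : e ∈ HomSub X X := by
    intro i
    by_cases hi : i.succ ≤ m
    · exact h4 i hi
    · have := hsub _ (not_le.1 hi)
      rcases src_or o i with ⟨hs, ht⟩ | ⟨hs, ht⟩
      · rw [← ht] at this
        ext y
        exact Subsingleton.elim _ _
      · rw [← hs] at this
        ext y
        rw [Subsingleton.elim y 0, map_zero, map_zero]
  have hne : e m ≠ 0 := by
    intro h
    rw [hem] at h
    have := LinearMap.congr_fun h x
    simp only [LinearMap.smulRight_apply, hg.1, one_smul, LinearMap.zero_apply] at this
    have h1 := hg.1
    rw [this, map_zero] at h1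
    exact zero_ne_one h1
  rcases hidem e hmem h2 with h | h
  · exact absurd (by rw [h]; rfl) hne
  · obtain ⟨y, η, hy⟩ := h3 v
    rw [h] at hy
    refine finrank_le_one y fun w => ⟨η w, ?_⟩
    simpa using (LinearMap.congr_fun hy w).symm

theorem Indecomposable.f_ne_zero {X : ARep n o} (hX : X.Indecomposable) (i : Fin n)
    {u w : Fin (n + 1)} (hu : u ≤ i.castSucc) (hw : i.succ ≤ w)
    (hu' : Nontrivial (X.M u)) (hw' : Nontrivial (X.M w)) : X.f i ≠ 0 := by
  intro hf
  let e : ∀ v, X.M v →ₗ[ℂ] X.M v := fun v => if v ≤ i.castSucc then LinearMap.id else 0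
  have he : e ∈ HomSub X X := by
    intro j
    by_cases hj : j = i
    · subst hj; simp [hf]
    · have : (ASrc o j ≤ i.castSucc ↔ ATgt o j ≤ i.castSucc) := by
        have : (j : ℕ) ≠ i := fun h => hj (Fin.ext h)
        rcases src_or o j with ⟨hs, ht⟩ | ⟨hs, ht⟩ <;> rw [hs, ht] <;>
          simp only [Fin.le_def, Fin.val_succ, Fin.val_castSucc] <;> omega
      by_cases hc : ATgt o j ≤ i.castSucc
      · simp [e, hc, this.2 hc]
      · simp [e, hc, mt this.1 hc]
  rcases hX.2 e he (fun v => by by_cases h : v ≤ i.castSucc <;> simp [e, h]) with h | h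
  · have := congrFun h u
    simp only [e, hu, if_true] at this
    obtain ⟨y, hy⟩ := exists_ne (0 : X.M u)
    exact hy (LinearMap.congr_fun this y)
  · have := congrFun h w
    have hw2 : ¬ w ≤ i.castSucc := not_le.2 (lt_of_lt_of_le Fin.castSucc_lt_succ hw)
    simp only [e, hw2, if_false] at this
    obtain ⟨y, hy⟩ := exists_ne (0 : X.M w)
    exact hy (LinearMap.congr_fun this y).symm

theorem nontrivial_of_ne {V W : Type} [AddCommGroup V] [Module ℂ V] [AddCommGroup W] [Module ℂ W]
    {f : V →ₗ[ℂ] W} (h : f ≠ 0) : Nontrivial V ∧ Nontrivial W := by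
  obtain ⟨y, hy⟩ : ∃ y, f y ≠ 0 := by
    by_contra hc
    push Not at hc
    exact h (LinearMap.ext hc)
  exact ⟨⟨y, 0, fun h0 => hy (by rw [h0, map_zero])⟩, ⟨_, _, hy⟩⟩

theorem Indecomposable.convex {X : ARep n o} (hX : X.Indecomposable)
    {u v w : Fin (n + 1)} (hu : u ≤ v) (hw : v ≤ w)
    (hu' : Nontrivial (X.M u)) (hw' : Nontrivial (X.M w)) : Nontrivial (X.M v) := by
  rcases hu.eq_or_lt with rfl | hlt
  · exact hu'
  · obtain ⟨i, rfl⟩ := Fin.exists_succ_eq.2 (Fin.ne_zero_of_lt hlt)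
    have := nontrivial_of_ne (hX.f_ne_zero i (Fin.le_castSucc_iff.2 hlt) hw hu' hw')
    rcases src_or o i with ⟨hs, ht⟩ | ⟨hs, ht⟩
    · rw [← ht]; exact this.2
    · rw [← hs]; exact this.1

theorem Indecomposable.bij {X : ARep n o} (hX : X.Indecomposable) (i : Fin n)
    (hs : Nontrivial (X.M (ASrc o i))) (ht : Nontrivial (X.M (ATgt o i))) :
    Function.Bijective (X.f i) := by
  have hf : X.f i ≠ 0 := by
    rcases src_or o i with ⟨h1, h2⟩ | ⟨h1, h2⟩
    · exact hX.f_ne_zero i h1.le h2.ge hs ht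
    · exact hX.f_ne_zero i h2.le h1.ge ht hs
  have e1 := hX.finrank_le (ASrc o i)
  have e2 := hX.finrank_le (ATgt o i)
  have p1 : 0 < Module.finrank ℂ (X.M (ASrc o i)) := Module.finrank_pos
  have p2 : 0 < Module.finrank ℂ (X.M (ATgt o i)) := Module.finrank_pos
  have hsurj : Function.Surjective (X.f i) := by
    have hr : LinearMap.range (X.f i) ≠ ⊥ := fun h => hf (LinearMap.range_eq_bot.1 h)
    have h1 : 1 ≤ Module.finrank ℂ (LinearMap.range (X.f i)) := Submodule.one_le_finrank_iff.2 hr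
    have h2 := Submodule.finrank_le (LinearMap.range (X.f i))
    exact LinearMap.range_eq_top.1 (Submodule.eq_top_of_finrank_eq (by omega))
  exact ⟨(LinearMap.injective_iff_surjective_of_finrank_eq_finrank (by omega)).2 hsurj, hsurj⟩

/-! ### Hom -/

theorem finrank_lin_le {V W : Type} [AddCommGroup V] [Module ℂ V] [AddCommGroup W] [Module ℂ W]
    [FiniteDimensional ℂ V] [FiniteDimensional ℂ W]
    (h1 : Module.finrank ℂ V ≤ 1) (h2 : Module.finrank ℂ W ≤ 1) :
    Module.finrank ℂ (V →ₗ[ℂ] W) ≤ 1 := by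
  rw [Module.finrank_linearMap]
  nlinarith

theorem lin_eq_of_not {V W : Type} [AddCommGroup V] [Module ℂ V] [AddCommGroup W] [Module ℂ W]
    (h : ¬ (Nontrivial V ∧ Nontrivial W)) (f g : V →ₗ[ℂ] W) : f = g := by
  by_contra hne
  exact h (nontrivial_of_ne (sub_ne_zero.2 hne))

/-- Common support. -/
def Both (L E : ARep n o) (v : Fin (n + 1)) : Prop := Nontrivial (L.M v) ∧ Nontrivial (E.M v)

theorem hom_edge {L E : ARep n o} (hL : L.Indecomposable) (hE : E.Indecomposable)
    {h : ∀ v, L.M v →ₗ[ℂ] E.M v} (hh : h ∈ HomSub L E) (i : Fin n)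
    (h1 : Both L E i.castSucc) (h2 : Both L E i.succ) :
    h i.castSucc = 0 ↔ h i.succ = 0 := by
  have key : Both L E (ASrc o i) → Both L E (ATgt o i) →
      (h (ASrc o i) = 0 ↔ h (ATgt o i) = 0) := by
    intro a b
    have bL := hL.bij i a.1 b.1
    have bE := hE.bij i a.2 b.2
    have hc := hh i
    constructor
    · intro h0
      rw [h0, LinearMap.comp_zero] at hc
      ext y
      obtain ⟨z, rfl⟩ := bL.2 y
      exact LinearMap.congr_fun hc z
    · intro h0
      rw [h0, LinearMap.zero_comp] at hc
      ext y
      apply bE.1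
      simpa using (LinearMap.congr_fun hc y).symm
  rcases src_or o i with ⟨hs, ht⟩ | ⟨hs, ht⟩
  · rw [hs, ht] at key; exact key h1 h2
  · rw [hs, ht] at key; exact (key h2 h1).symm

theorem Both.convex {L E : ARep n o} (hL : L.Indecomposable) (hE : E.Indecomposable)
    {u v w : Fin (n + 1)} (hu : u ≤ v) (hw : v ≤ w) (a : Both L E u) (b : Both L E w) :
    Both L E v :=
  ⟨hL.convex hu hw a.1 b.1, hE.convex hu hw a.2 b.2⟩

theorem hom_zero {L E : ARep n o} (hL : L.Indecomposable) (hE : E.Indecomposable)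
    {h : ∀ v, L.M v →ₗ[ℂ] E.M v} (hh : h ∈ HomSub L E) (c : Fin (n + 1)) (hc : Both L E c)
    (h0 : h c = 0) : h = 0 := by
  have up : ∀ v, c ≤ v → Both L E v → h v = 0 := by
    intro v
    induction v using Fin.induction with
    | zero =>
      intro hv _
      obtain rfl := Fin.le_zero_iff.1 hv
      exact h0
    | succ i ih =>
      intro hv hb
      rcases hv.eq_or_lt with rfl | hlt
      · exact h0
      · have hle := Fin.le_castSucc_iff.2 hlt
        have hb' := Both.convex hL hE hle Fin.castSucc_lt_succ.le hc hb
        exact (hom_edge hL hE hh i hb' hb).1 (ih hle hb')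
  have down : ∀ v, v ≤ c → Both L E v → h v = 0 := by
    intro v
    induction v using Fin.reverseInduction with
    | last =>
      intro hv _
      obtain rfl := Fin.last_le_iff.1 hv
      exact h0
    | cast i ih =>
      intro hv hb
      rcases hv.eq_or_lt with rfl | hlt
      · exact h0
      · have hle : i.succ ≤ c := Fin.castSucc_lt_iff_succ_le.1 hlt
        have hb' := Both.convex hL hE Fin.castSucc_lt_succ.le hle hb hc
        exact (hom_edge hL hE hh i hb hb').2 (ih hle hb')
  funext v
  by_cases hv : Both L E v
  · rcases le_total c v with hcv | hcv
    · exact up v hcv hv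
    · exact down v hcv hv
  · exact lin_eq_of_not hv _ _

theorem dimHom_le {L E : ARep n o} (hL : L.Indecomposable) (hE : E.Indecomposable) :
    dimHom L E ≤ 1 := by
  unfold dimHom
  by_cases hc : ∃ c, Both L E c
  · obtain ⟨c, hc⟩ := hc
    refine le_trans (LinearMap.finrank_le_finrank_of_injective
      (f := (LinearMap.proj c : (∀ v, L.M v →ₗ[ℂ] E.M v) →ₗ[ℂ] _) ∘ₗ (HomSub L E).subtype) ?_)
      (finrank_lin_le (hL.finrank_le c) (hE.finrank_le c))
    rw [injective_iff_map_eq_zero]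
    intro a ha
    exact Subtype.ext (hom_zero hL hE a.2 c hc ha)
  · push Not at hc
    have : Subsingleton (HomSub L E) := ⟨fun a b => Subtype.ext (funext fun v =>
      lin_eq_of_not (hc v) _ _)⟩
    rw [Module.finrank_zero_of_subsingleton]
    exact zero_le_one

/-! ### Ext -/

/-- The `i`-th equation. -/
def Solves (L E : ARep n o) (φ : ∀ i : Fin n, L.M (ASrc o i) →ₗ[ℂ] E.M (ATgt o i))
    (h : ∀ v, L.M v →ₗ[ℂ] E.M v) (i : Fin n) : Prop :=
  (E.f i).comp (h (ASrc o i)) - (h (ATgt o i)).comp (L.f i) = φ i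

theorem solve_edge {L E : ARep n o} (hL : L.Indecomposable) (hE : E.Indecomposable)
    (φ : ∀ i : Fin n, L.M (ASrc o i) →ₗ[ℂ] E.M (ATgt o i)) (i : Fin n)
    (hi : Nontrivial (L.M (ASrc o i)) ∧ Nontrivial (E.M (ATgt o i)) → Both L E i.succ)
    (h : ∀ v, L.M v →ₗ[ℂ] E.M v) : ∃ g, Solves L E φ (Function.update h i.succ g) i := by
  by_cases hx : Nontrivial (L.M (ASrc o i)) ∧ Nontrivial (E.M (ATgt o i))
  swap
  · exact ⟨0, lin_eq_of_not hx _ _⟩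
  have hb := hi hx
  rcases src_or o i with ⟨hs, ht⟩ | ⟨hs, ht⟩
  · rw [← ht] at hb ⊢
    let eL := LinearEquiv.ofBijective (L.f i) (hL.bij i hx.1 hb.1)
    refine ⟨((E.f i).comp (h (ASrc o i)) - φ i).comp (eL.symm : _ →ₗ[ℂ] _), ?_⟩
    unfold Solves
    rw [Function.update_self, Function.update_of_ne (src_ne_tgt o i)]
    ext y
    have : eL.symm (L.f i y) = y := eL.symm_apply_apply y
    simp [this]
  · rw [← hs] at hb ⊢
    let eE := LinearEquiv.ofBijective (E.f i) (hE.bij i hb.2 hx.2)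
    refine ⟨(eE.symm : _ →ₗ[ℂ] _).comp ((h (ATgt o i)).comp (L.f i) + φ i), ?_⟩
    unfold Solves
    rw [Function.update_self, Function.update_of_ne (src_ne_tgt o i).symm]
    ext y
    have : ∀ z, E.f i (eE.symm z) = z := eE.apply_symm_apply
    simp only [LinearMap.sub_apply, LinearMap.comp_apply, LinearEquiv.coe_coe, this]
    simp

theorem solve_all {L E : ARep n o} (hL : L.Indecomposable) (hE : E.Indecomposable)
    (φ : ∀ i : Fin n, L.M (ASrc o i) →ₗ[ℂ] E.M (ATgt o i)) (v : Fin (n + 1)) :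
    ∃ h, ∀ i : Fin n, i.succ ≤ v →
      (Nontrivial (L.M (ASrc o i)) ∧ Nontrivial (E.M (ATgt o i)) → Both L E i.succ) →
      Solves L E φ h i := by
  induction v using Fin.induction with
  | zero => exact ⟨0, fun i hi => absurd hi (by simp)⟩
  | succ i ih =>
    obtain ⟨h, hh⟩ := ih
    by_cases hi : Nontrivial (L.M (ASrc o i)) ∧ Nontrivial (E.M (ATgt o i)) → Both L E i.succ
    · obtain ⟨g, hg⟩ := solve_edge hL hE φ i hi h
      refine ⟨Function.update h i.succ g, fun j hj hjb => ?_⟩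
      by_cases hji : j = i
      · subst hji; exact hg
      · have hlt : j.succ ≤ i.castSucc := by
          simp only [Fin.le_def, Fin.val_succ, Fin.val_castSucc] at hj ⊢
          have : (j : ℕ) ≠ i := fun h => hji (Fin.ext h)
          omega
        have hlt' : j.succ < i.succ := lt_of_le_of_lt hlt Fin.castSucc_lt_succ
        unfold Solves
        rw [Function.update_of_ne (lt_of_le_of_lt (src_le o j) hlt').ne,
          Function.update_of_ne (lt_of_le_of_lt (tgt_le o j) hlt').ne]
        exact hh j hlt hjb
    · refine ⟨h, fun j hj hjb => ?_⟩
      by_cases hji : j = i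
      · subst hji; exact absurd hjb hi
      · refine hh j ?_ hjb
        simp only [Fin.le_def, Fin.val_succ, Fin.val_castSucc] at hj ⊢
        have : (j : ℕ) ≠ i := fun h => hji (Fin.ext h)
        omega

theorem bad_lt {L E : ARep n o} (hL : L.Indecomposable) (hE : E.Indecomposable) {i j : Fin n}
    (hij : i < j) (hi : Nontrivial (L.M (ASrc o i)) ∧ Nontrivial (E.M (ATgt o i)))
    (hj : Nontrivial (L.M (ASrc o j)) ∧ Nontrivial (E.M (ATgt o j))) : Both L E i.succ := by
  have hle : i.succ ≤ j.castSucc := by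
    simp only [Fin.le_def, Fin.lt_def, Fin.val_succ, Fin.val_castSucc] at hij ⊢
    omega
  exact ⟨hL.convex (src_le o i) (hle.trans (le_src o j)) hi.1 hj.1,
    hE.convex (tgt_le o i) (hle.trans (le_tgt o j)) hi.2 hj.2⟩

theorem dimExt_le {L E : ARep n o} (hL : L.Indecomposable) (hE : E.Indecomposable) :
    dimExt L E ≤ 1 := by
  unfold dimExt
  by_cases hbad : ∃ i : Fin n,
      ¬ (Nontrivial (L.M (ASrc o i)) ∧ Nontrivial (E.M (ATgt o i)) → Both L E i.succ)
  · obtain ⟨i, hi⟩ := hbad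
    have hi' := Classical.not_imp.1 hi
    have hgood : ∀ j, j ≠ i →
        (Nontrivial (L.M (ASrc o j)) ∧ Nontrivial (E.M (ATgt o j)) → Both L E j.succ) := by
      intro j hji hj
      rcases lt_or_gt_of_ne hji with h | h
      · exact bad_lt hL hE h hj hi'.1
      · exact absurd (bad_lt hL hE h hi'.1 hj) hi'.2
    refine le_trans (LinearMap.finrank_le_finrank_of_surjective
      (f := (LinearMap.range (extMap L E)).mkQ ∘ₗ
        LinearMap.single ℂ (fun i : Fin n => L.M (ASrc o i) →ₗ[ℂ] E.M (ATgt o i)) i) ?_)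
      (finrank_lin_le (hL.finrank_le _) (hE.finrank_le _))
    intro q
    obtain ⟨φ, rfl⟩ := Submodule.mkQ_surjective _ q
    obtain ⟨h, hh⟩ := solve_all hL hE φ (Fin.last n)
    refine ⟨(φ - extMap L E h) i, ?_⟩
    have : LinearMap.single ℂ (fun i : Fin n => L.M (ASrc o i) →ₗ[ℂ] E.M (ATgt o i)) i
        ((φ - extMap L E h) i) = φ - extMap L E h := by
      funext j
      by_cases hji : j = i
      · subst hji; simp
      · have hs : extMap L E h j = φ j := hh j (Fin.le_last _) (hgood j hji)
        simp [Pi.single_eq_of_ne hji, hs]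
    rw [LinearMap.comp_apply, this, map_sub, sub_eq_self]
    simp
  · push Not at hbad
    have htop : LinearMap.range (extMap L E) = ⊤ := by
      rw [LinearMap.range_eq_top]
      intro φ
      obtain ⟨h, hh⟩ := solve_all hL hE φ (Fin.last n)
      exact ⟨h, funext fun j => hh j (Fin.le_last _) (hbad j)⟩
    rw [htop, Module.finrank_zero_of_subsingleton]
    exact zero_le_one

end ARep

open ARep in
/-- For indecomposable representations `L`, `E` of a quiver of type `A`
(here `A_{n+1}`, any `n`, any orientation), `dim Hom(L,E) ≤ 1` and `dim Ext¹(L,E) ≤ 1`. -/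
theorem ARep.dimHom_le_one_and_dimExt_le_one
    {n : ℕ} {o : Fin n → Bool} (L E : ARep n o)
    (hL : L.Indecomposable) (hE : E.Indecomposable) :
    dimHom L E ≤ 1 ∧ dimExt L E ≤ 1 := by
  exact ⟨dimHom_le hL hE, dimExt_le hL hE⟩
end

section
/- Let Q be a quiver of type A_n and let L, E be indecomposable representations with dim Ext¹(E,L) = 1. Let 0 → L → F → E → 0 be a non-split short exact sequence. Then: (a) Ext¹(F,F) = 0; (b) F has at most two indecomposable direct summands; (c) F is indecomposable if and only if Hom(L,E) = 0; (d) Ext¹(F,L) = 0 and Ext¹(E,F) = 0. -/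
namespace ARep

variable {n : ℕ} {o : Fin n → Bool}

/-! ### Edges -/

theorem src_tgt_val (o : Fin n → Bool) (i : Fin n) :
    ((ASrc o i).val = i.val ∧ (ATgt o i).val = i.val + 1 ∧ o i = true) ∨
    ((ASrc o i).val = i.val + 1 ∧ (ATgt o i).val = i.val ∧ o i = false) := by
  unfold ASrc ATgt
  cases h : o i <;> simp

theorem edge_cases (X : ARep n o) (i : Fin n) :
    (∃ g : X.M i.castSucc →ₗ[ℂ] X.M i.succ, o i = true ∧
      (∀ x : ∀ v, X.M v, X.f i (x (ASrc o i)) = x (ATgt o i) ↔ g (x i.castSucc) = x i.succ) ∧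
      (∀ φ : ∀ v, X.M v →ₗ[ℂ] ℂ, (∀ z, φ (ATgt o i) (X.f i z) = φ (ASrc o i) z) ↔
        ∀ z, φ i.succ (g z) = φ i.castSucc z) ∧
      (∀ x : ∀ v, X.M v, X.f i (x (ASrc o i)) = 0 ↔ g (x i.castSucc) = 0)) ∨
    (∃ g : X.M i.succ →ₗ[ℂ] X.M i.castSucc, o i = false ∧
      (∀ x : ∀ v, X.M v, X.f i (x (ASrc o i)) = x (ATgt o i) ↔ g (x i.succ) = x i.castSucc) ∧
      (∀ φ : ∀ v, X.M v →ₗ[ℂ] ℂ, (∀ z, φ (ATgt o i) (X.f i z) = φ (ASrc o i) z) ↔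
        ∀ z, φ i.castSucc (g z) = φ i.succ z) ∧
      (∀ φ : ∀ v, X.M v →ₗ[ℂ] ℂ, (∀ z, φ (ATgt o i) (X.f i z) = 0) ↔
        ∀ z, φ i.castSucc (g z) = 0)) := by
  generalize X.f i = g
  cases h : o i
  · right
    have hs : ASrc o i = i.succ := by simp [ASrc, h]
    have ht : ATgt o i = i.castSucc := by simp [ATgt, h]
    revert g
    rw [hs, ht]
    intro g
    exact ⟨g, rfl, fun _ => Iff.rfl, fun _ => Iff.rfl, fun _ => Iff.rfl⟩
  · left
    have hs : ASrc o i = i.castSucc := by simp [ASrc, h]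
    have ht : ATgt o i = i.succ := by simp [ATgt, h]
    revert g
    rw [hs, ht]
    intro g
    exact ⟨g, rfl, fun _ => Iff.rfl, fun _ => Iff.rfl, fun _ => Iff.rfl⟩

/-! ### Existence of an interval summand -/

/-- Compatible vectors on the segment `[a,k]`. -/
def CompX (X : ARep n o) (a k : ℕ) (x : ∀ v, X.M v) : Prop :=
  ∀ i : Fin n, a ≤ i.val → i.val < k → X.f i (x (ASrc o i)) = x (ATgt o i)

/-- Compatible functionals on the segment `[a,k]`. -/
def CompF (X : ARep n o) (a k : ℕ) (φ : ∀ v, X.M v →ₗ[ℂ] ℂ) : Prop :=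
  ∀ i : Fin n, a ≤ i.val → i.val < k → ∀ z, φ (ATgt o i) (X.f i z) = φ (ASrc o i) z

/-- There is an interval summand starting at `a` (up to what happens to the left of `a`). -/
def HasInt (X : ARep n o) (a : ℕ) : Prop :=
  ∃ b : Fin (n + 1), a ≤ b.val ∧ ∃ (x : ∀ v, X.M v) (φ : ∀ v, X.M v →ₗ[ℂ] ℂ),
    CompX X a b.val x ∧ CompF X a b.val φ ∧ φ b (x b) = 1 ∧
    ∀ i : Fin n, i.val = b.val → (o i = true → X.f i (x (ASrc o i)) = 0) ∧
      (o i = false → ∀ z, φ (ATgt o i) (X.f i z) = 0)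

/-- The marching state at the vertex `k`. -/
def State (X : ARep n o) (a : ℕ) (k : Fin (n + 1)) : Prop :=
  ∃ A B : Submodule ℂ (X.M k), A ≤ B ∧ (∃ y ∈ B, y ∉ A) ∧
    (∀ y ∈ B, ∃ x : ∀ v, X.M v, x k = y ∧ CompX X a k.val x) ∧
    (∀ ψ : X.M k →ₗ[ℂ] ℂ, (∀ z ∈ A, ψ z = 0) →
      ∃ φ : ∀ v, X.M v →ₗ[ℂ] ℂ, φ k = ψ ∧ CompF X a k.val φ)

theorem exists_functional {V : Type*} [AddCommGroup V] [Module ℂ V] (A : Submodule ℂ V) {y : V}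
    (hy : y ∉ A) : ∃ ψ : V →ₗ[ℂ] ℂ, ψ y = 1 ∧ ∀ z ∈ A, ψ z = 0 := by
  obtain ⟨f, hf, hA⟩ := Submodule.exists_le_ker_of_notMem hy
  refine ⟨(f y)⁻¹ • f, by simp [hf], fun z hz => ?_⟩
  have := hA hz
  simp only [LinearMap.mem_ker] at this
  simp [this]

theorem extend_functional {V W : Type*} [AddCommGroup V] [Module ℂ V] [AddCommGroup W]
    [Module ℂ W] (g : W →ₗ[ℂ] V) (A : Submodule ℂ V) (ψ : W →ₗ[ℂ] ℂ)
    (hψ : ∀ z, g z ∈ A → ψ z = 0) :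
    ∃ ψ' : V →ₗ[ℂ] ℂ, (∀ z ∈ A, ψ' z = 0) ∧ ∀ z, ψ' (g z) = ψ z := by
  have hker : LinearMap.ker (A.mkQ.comp g) ≤ LinearMap.ker ψ := by
    intro z hz
    simp only [LinearMap.mem_ker, LinearMap.comp_apply, Submodule.mkQ_apply,
      Submodule.Quotient.mk_eq_zero] at hz
    exact hψ z hz
  obtain ⟨r, hr⟩ := LinearMap.exists_extend
    (((LinearMap.ker (A.mkQ.comp g)).liftQ ψ hker).comp
      (A.mkQ.comp g).quotKerEquivRange.symm.toLinearMap)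
  refine ⟨r.comp A.mkQ, fun z hz => ?_, fun z => ?_⟩
  · simp [(Submodule.Quotient.mk_eq_zero A).2 hz]
  · have := LinearMap.congr_fun hr ⟨A.mkQ.comp g z, LinearMap.mem_range_self _ z⟩
    simp only [LinearMap.comp_apply, Submodule.subtype_apply] at this
    rw [LinearMap.comp_apply, this]
    have h2 : (A.mkQ.comp g).quotKerEquivRange.symm
        ⟨A.mkQ.comp g z, LinearMap.mem_range_self _ z⟩ = Submodule.Quotient.mk z := by
      rw [LinearEquiv.symm_apply_eq]
      rfl
    simp only [LinearEquiv.coe_coe]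
    erw [h2]
    rfl

theorem CompX.update {X : ARep n o} {a : ℕ} {i : Fin n} {x : ∀ v, X.M v}
    (hx : CompX X a i.castSucc.val x) (y : X.M i.succ)
    (h : X.f i (Function.update x i.succ y (ASrc o i)) = Function.update x i.succ y (ATgt o i)) :
    CompX X a i.succ.val (Function.update x i.succ y) := by
  intro j haj hj
  rcases eq_or_ne j i with rfl | hne
  · exact h
  · have hlt : j.val < i.val := by
      have : j.val ≠ i.val := fun h => hne (Fin.ext h)
      simp at hj
      omega
    have h1 : ASrc o j ≠ i.succ := by
      intro h
      have := congrArg Fin.val h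
      have := src_tgt_val o j
      simp at *
      omega
    have h2 : ATgt o j ≠ i.succ := by
      intro h
      have := congrArg Fin.val h
      have := src_tgt_val o j
      simp at *
      omega
    rw [Function.update_of_ne h1, Function.update_of_ne h2]
    exact hx j haj hlt

theorem CompF.update {X : ARep n o} {a : ℕ} {i : Fin n} {x : ∀ v, X.M v →ₗ[ℂ] ℂ}
    (hx : CompF X a i.castSucc.val x) (y : X.M i.succ →ₗ[ℂ] ℂ)
    (h : ∀ z, Function.update x i.succ y (ATgt o i) (X.f i z)
      = Function.update x i.succ y (ASrc o i) z) :
    CompF X a i.succ.val (Function.update x i.succ y) := by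
  intro j haj hj
  rcases eq_or_ne j i with rfl | hne
  · exact h
  · have hlt : j.val < i.val := by
      have : j.val ≠ i.val := fun h => hne (Fin.ext h)
      simp at hj
      omega
    have h1 : ASrc o j ≠ i.succ := by
      intro h
      have := congrArg Fin.val h
      have := src_tgt_val o j
      simp at *
      omega
    have h2 : ATgt o j ≠ i.succ := by
      intro h
      have := congrArg Fin.val h
      have := src_tgt_val o j
      simp at *
      omega
    rw [Function.update_of_ne h1, Function.update_of_ne h2]
    exact hx j haj hlt

theorem castSucc_ne_succ' (i : Fin n) : i.castSucc ≠ i.succ := by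
  intro h
  have := congrArg Fin.val h
  simp at this

theorem State.step {X : ARep n o} {a : ℕ} (i : Fin n) (hai : a ≤ i.val)
    (hS : State X a i.castSucc) : HasInt X a ∨ State X a i.succ := by
  obtain ⟨A, B, hAB, ⟨y, hyB, hyA⟩, hX, hF⟩ := hS
  have hne := castSucc_ne_succ' i
  rcases edge_cases X i with ⟨g, ho, h1, h2, h3⟩ | ⟨g, ho, h1, h2, h3⟩
  · by_cases hk : ∃ z ∈ B, g z = 0 ∧ z ∉ A
    · left
      obtain ⟨z, hzB, hz0, hzA⟩ := hk
      obtain ⟨ψ, hψ1, hψA⟩ := exists_functional A hzA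
      obtain ⟨x, hxz, hx⟩ := hX z hzB
      obtain ⟨φ, hφψ, hφ⟩ := hF ψ hψA
      refine ⟨i.castSucc, by simpa using hai, x, φ, hx, hφ, by rw [hxz, hφψ, hψ1], ?_⟩
      intro j hj
      have : j = i := Fin.ext (by simpa using hj)
      subst this
      refine ⟨fun _ => (h3 x).2 (by rw [hxz, hz0]), fun h => by simp [ho] at h⟩
    · right
      push Not at hk
      refine ⟨A.map g, B.map g, Submodule.map_mono hAB, ⟨g y, Submodule.mem_map_of_mem hyB, ?_⟩, ?_, ?_⟩
      · rintro ⟨z, hzA, hz⟩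
        have := hk (y - z) (B.sub_mem hyB (hAB hzA)) (by simp [hz])
        exact hyA (by simpa using A.add_mem this hzA)
      · rintro _ ⟨z, hzB, rfl⟩
        obtain ⟨x, hxz, hx⟩ := hX z hzB
        refine ⟨Function.update x i.succ (g z), by simp, hx.update _ ?_⟩
        rw [h1]
        simp [Function.update_of_ne hne, hxz]
      · intro ψ hψ
        obtain ⟨φ, hφψ, hφ⟩ := hF (ψ.comp g) (fun z hz => hψ _ (Submodule.mem_map_of_mem hz))
        refine ⟨Function.update φ i.succ ψ, by simp, hφ.update _ ?_⟩
        rw [h2]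
        simp [Function.update_of_ne hne, hφψ]
  · by_cases hk : ∃ z ∈ B, z ∉ A ⊔ LinearMap.range g
    · left
      obtain ⟨z, hzB, hzA⟩ := hk
      obtain ⟨ψ, hψ1, hψA⟩ := exists_functional _ hzA
      obtain ⟨x, hxz, hx⟩ := hX z hzB
      obtain ⟨φ, hφψ, hφ⟩ := hF ψ (fun z hz => hψA z (Submodule.mem_sup_left hz))
      refine ⟨i.castSucc, by simpa using hai, x, φ, hx, hφ, by rw [hxz, hφψ, hψ1], ?_⟩
      intro j hj
      have : j = i := Fin.ext (by simpa using hj)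
      subst this
      refine ⟨fun h => by simp [ho] at h, fun _ => (h3 φ).2 fun z => ?_⟩
      rw [hφψ]
      exact hψA _ (Submodule.mem_sup_right ⟨z, rfl⟩)
    · right
      push Not at hk
      refine ⟨A.comap g, B.comap g, Submodule.comap_mono hAB, ?_, ?_, ?_⟩
      · obtain ⟨z, hz, w, ⟨u, rfl⟩, hzw⟩ := Submodule.mem_sup.1 (hk y hyB)
        refine ⟨u, ?_, fun h => hyA (hzw ▸ A.add_mem hz h)⟩
        have : g u = y - z := by rw [← hzw]; simp
        change g u ∈ B
        rw [this]
        exact B.sub_mem hyB (hAB hz)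
      · intro z hzB
        obtain ⟨x, hxz, hx⟩ := hX (g z) hzB
        refine ⟨Function.update x i.succ z, by simp, hx.update _ ?_⟩
        rw [h1]
        simp [Function.update_of_ne hne, hxz]
      · intro ψ hψ
        obtain ⟨ψ', h4, h5⟩ := extend_functional g A ψ (fun z hz => hψ z hz)
        obtain ⟨φ, hφψ, hφ⟩ := hF ψ' h4
        refine ⟨Function.update φ i.succ ψ, by simp, hφ.update _ ?_⟩
        rw [h2]
        simp [Function.update_of_ne hne, hφψ, h5]

theorem State.start (X : ARep n o) (a : Fin (n + 1)) (y : X.M a) (hy : y ≠ 0) :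
    State X a.val a := by
  refine ⟨⊥, ⊤, bot_le, ⟨y, trivial, by simpa using hy⟩, ?_, ?_⟩
  · intro y _
    refine ⟨Function.update (fun _ => 0) a y, by simp, fun i h1 h2 => by omega⟩
  · intro ψ _
    refine ⟨Function.update (fun _ => 0) a ψ, by simp, fun i h1 h2 => by omega⟩

theorem hasInt_or_state (X : ARep n o) (a : Fin (n + 1)) (y : X.M a) (hy : y ≠ 0) (k : ℕ)
    (hak : a.val ≤ k) : ∀ hk : k < n + 1, HasInt X a.val ∨ State X a.val ⟨k, hk⟩ := by
  induction k, hak using Nat.le_induction with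
  | base => intro hk; exact Or.inr (State.start X a y hy)
  | succ k hak ih =>
    intro hk
    rcases ih (by omega) with h | h
    · exact Or.inl h
    · exact State.step (⟨k, by omega⟩ : Fin n) hak h

theorem hasInt (X : ARep n o) (a : Fin (n + 1)) (y : X.M a) (hy : y ≠ 0) :
    HasInt X a.val := by
  rcases hasInt_or_state X a y hy n (by omega) (by omega) with h | h
  · exact h
  · obtain ⟨A, B, hAB, ⟨y, hyB, hyA⟩, hX, hF⟩ := h
    obtain ⟨ψ, hψ1, hψA⟩ := exists_functional A hyA
    obtain ⟨x, hxz, hx⟩ := hX y hyB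
    obtain ⟨φ, hφψ, hφ⟩ := hF ψ hψA
    refine ⟨⟨n, by omega⟩, by simp; omega, x, φ, hx, hφ, by rw [hxz, hφψ, hψ1], ?_⟩
    intro i hi
    have := i.2
    simp at hi
    omega

/-- `X` is an interval module with support `[a,b]`, basis vectors `x` and dual basis `φ`. -/
structure IsInt (X : ARep n o) (a b : ℕ) (x : ∀ v, X.M v) (φ : ∀ v, X.M v →ₗ[ℂ] ℂ) : Prop where
  hab : a ≤ b
  hbn : b ≤ n
  x_out : ∀ v, ¬ (a ≤ v.val ∧ v.val ≤ b) → x v = 0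
  φ_out : ∀ v, ¬ (a ≤ v.val ∧ v.val ≤ b) → φ v = 0
  one : ∀ v, a ≤ v.val → v.val ≤ b → φ v (x v) = 1
  eq : ∀ v (z : X.M v), z = φ v z • x v
  edge : ∀ i, (a ≤ (ASrc o i).val ∧ (ASrc o i).val ≤ b) →
    (a ≤ (ATgt o i).val ∧ (ATgt o i).val ≤ b) → X.f i (x (ASrc o i)) = x (ATgt o i)

theorem Indecomposable.isInt {X : ARep n o} (hX : X.Indecomposable) :
    ∃ a b x φ, IsInt X a b x φ := by
  classical
  obtain ⟨⟨v, y, hy⟩, hid⟩ := hX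
  obtain ⟨a, ⟨ya, hya⟩, hmin⟩ : ∃ a : Fin (n + 1), (∃ y : X.M a, y ≠ 0) ∧
      ∀ v : Fin (n + 1), v.val < a.val → ∀ y : X.M v, y = 0 := by
    have hwf := WellFounded.has_min (wellFounded_lt : WellFounded ((· < ·) : Fin (n+1) → _ → Prop))
      {a | ∃ y : X.M a, y ≠ 0} ⟨v, y, hy⟩
    obtain ⟨a, ha, hmin⟩ := hwf
    refine ⟨a, ha, fun v hv y => ?_⟩
    by_contra hne
    exact hmin v ⟨y, hne⟩ hv
  obtain ⟨b, hab, x, φ, hx, hφ, h1, hend⟩ := hasInt X a ya hya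
  set x' : ∀ v, X.M v := fun v => if a.val ≤ v.val ∧ v.val ≤ b.val then x v else 0 with hx'
  set φ' : ∀ v, X.M v →ₗ[ℂ] ℂ := fun v => if a.val ≤ v.val ∧ v.val ≤ b.val then φ v else 0 with hφ'
  have hx'in : ∀ v, (a.val ≤ v.val ∧ v.val ≤ b.val) → x' v = x v := fun v h => by
    simp only [hx', if_pos h]
  have hφ'in : ∀ v, (a.val ≤ v.val ∧ v.val ≤ b.val) → φ' v = φ v := fun v h => by
    simp only [hφ', if_pos h]
  have hx'out : ∀ v, ¬ (a.val ≤ v.val ∧ v.val ≤ b.val) → x' v = 0 := fun v h => by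
    simp only [hx', if_neg h]
  have hφ'out : ∀ v, ¬ (a.val ≤ v.val ∧ v.val ≤ b.val) → φ' v = 0 := fun v h => by
    simp only [hφ', if_neg h]
  have hedge : ∀ i, (a.val ≤ (ASrc o i).val ∧ (ASrc o i).val ≤ b.val) →
    (a.val ≤ (ATgt o i).val ∧ (ATgt o i).val ≤ b.val) → X.f i (x' (ASrc o i)) = x' (ATgt o i) := by
    intro i hs ht
    rw [hx'in _ hs, hx'in _ ht]
    have := src_tgt_val o i
    exact hx i (by omega) (by omega)
  have hone : ∀ k : ℕ, ∀ v : Fin (n + 1), v.val + k = b.val → a.val ≤ v.val → φ v (x v) = 1 := by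
    intro k
    induction k with
    | zero =>
      intro v hv _
      have : v = b := Fin.ext (by simpa using hv)
      rw [this, h1]
    | succ k ih =>
      intro v hv hav
      have hvn : v.val < n := by omega
      have h3 := ih (⟨v.val, hvn⟩ : Fin n).succ (by simp; omega) (by simp; omega)
      have h4 := hx ⟨v.val, hvn⟩ hav (by simp; omega)
      have h5 := hφ ⟨v.val, hvn⟩ hav (by simp; omega)
      have h6 : (⟨v.val, hvn⟩ : Fin n).castSucc = v := rfl
      rcases edge_cases X ⟨v.val, hvn⟩ with ⟨g, ho, h1, h2, -⟩ | ⟨g, ho, h1, h2, -⟩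
      · rw [h1] at h4
        rw [h2] at h5
        rw [← h4, h5] at h3
        exact h3
      · rw [h1] at h4
        rw [h2] at h5
        rw [← h5, h4] at h3
        exact h3
  have hone' : ∀ v : Fin (n + 1), a.val ≤ v.val → v.val ≤ b.val → φ' v (x' v) = 1 := by
    intro v h2 h3
    rw [hx'in v ⟨h2, h3⟩, hφ'in v ⟨h2, h3⟩]
    exact hone (b.val - v.val) v (by omega) h2
  let e : ∀ v, X.M v →ₗ[ℂ] X.M v := fun v => (φ' v).smulRight (x' v)
  have he : ∀ v z, e v z = φ' v z • x' v := fun v z => rfl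
  have heH : e ∈ HomSub X X := by
    intro i
    ext z
    simp only [LinearMap.comp_apply, he, map_smul]
    have hst := src_tgt_val o i
    by_cases hs : a.val ≤ (ASrc o i).val ∧ (ASrc o i).val ≤ b.val <;>
    by_cases ht : a.val ≤ (ATgt o i).val ∧ (ATgt o i).val ≤ b.val
    · rw [hedge i hs ht, hφ'in _ hs, hφ'in _ ht, hφ i (by omega) (by omega)]
    · rw [hx'out _ ht]
      by_cases hta : (ATgt o i).val < a.val
      · rw [hmin _ hta (X.f i (x' (ASrc o i)))]; simp
      · rw [hx'in _ hs, (hend i (by omega)).1 (by grind)]; simp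
    · rw [hx'out _ hs]
      by_cases hta : (ASrc o i).val < a.val
      · rw [hmin _ hta z]; simp
      · rw [hφ'in _ ht, (hend i (by omega)).2 (by grind)]; simp
    · rw [hx'out _ hs, hx'out _ ht]; simp
  have hid' : ∀ v, (e v).comp (e v) = e v := by
    intro v
    ext z
    simp only [LinearMap.comp_apply, he, map_smul]
    by_cases hv : a.val ≤ v.val ∧ v.val ≤ b.val
    · rw [hone' v hv.1 hv.2]; simp
    · rw [hx'out _ hv]; simp
  refine ⟨a.val, b.val, x', φ', ⟨hab, by omega, hx'out, hφ'out, hone', ?_, hedge⟩⟩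
  rcases hid e heH hid' with h | h
  · exfalso
    have h2 : e a (x' a) = 0 := by rw [h]; rfl
    have h3 := hone' a le_rfl hab
    rw [he, h3, one_smul] at h2
    rw [h2] at h3
    simp at h3
  · intro v z
    rw [← he, h]
    rfl

/-! ### Euler form -/

theorem homSub_eq_ker (X Y : ARep n o) : HomSub X Y = LinearMap.ker (extMap X Y) := by
  ext h
  rw [LinearMap.mem_ker, funext_iff]
  refine forall_congr' fun i => ?_
  rw [Pi.zero_apply, eq_comm]
  exact sub_eq_zero.symm

theorem dimExt_eq_zero_iff (X Y : ARep n o) :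
    dimExt X Y = 0 ↔ ∀ g, ∃ h, extMap X Y h = g := by
  unfold dimExt
  rw [Module.finrank_zero_iff, Submodule.Quotient.subsingleton_iff,
    LinearMap.range_eq_top]
  rfl

theorem euler (X Y : ARep n o) :
    (dimHom X Y : ℤ) - dimExt X Y =
      ∑ v, (Module.finrank ℂ (X.M v) : ℤ) * Module.finrank ℂ (Y.M v)
      - ∑ i, (Module.finrank ℂ (X.M (ASrc o i)) : ℤ) * Module.finrank ℂ (Y.M (ATgt o i)) := by
  have h1 := (extMap X Y).finrank_range_add_finrank_ker
  have h2 := (LinearMap.range (extMap X Y)).finrank_quotient_add_finrank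
  rw [← homSub_eq_ker] at h1
  change dimExt X Y + _ = _ at h2
  change _ + dimHom X Y = _ at h1
  rw [Module.finrank_pi_fintype] at h1 h2
  simp only [Module.finrank_linearMap] at h1 h2
  zify at h1 h2
  linarith

/-! ### Hom and Ext between interval modules -/

/-- Membership of a vertex in an interval. -/
def In (a b : ℕ) (v : Fin (n + 1)) : Prop := a ≤ v.val ∧ v.val ≤ b

theorem IsInt.f_x {X : ARep n o} {a b x φ} (hX : IsInt X a b x φ) (i : Fin n)
    (hs : In a b (ASrc o i)) : X.f i (x (ASrc o i)) = x (ATgt o i) := by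
  by_cases ht : In a b (ATgt o i)
  · exact hX.edge i hs ht
  · rw [hX.eq _ (X.f i _), hX.x_out _ ht, smul_zero]

open Classical in
theorem ext_zero_of_scalars {X Y : ARep n o} {a b x φ c d y ψ} (hX : IsInt X a b x φ)
    (hY : IsInt Y c d y ψ)
    (H : ∀ γ : Fin n → ℂ, ∃ η : Fin (n + 1) → ℂ, ∀ i, In a b (ASrc o i) → In c d (ATgt o i) →
      (if In c d (ASrc o i) then η (ASrc o i) else 0)
        - (if In a b (ATgt o i) then η (ATgt o i) else 0) = γ i) : dimExt X Y = 0 := by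
  rw [dimExt_eq_zero_iff]
  intro g
  obtain ⟨η, hη⟩ := H (fun i => ψ (ATgt o i) (g i (x (ASrc o i))))
  refine ⟨fun v => η v • (φ v).smulRight (y v), ?_⟩
  funext i
  by_cases ht : In c d (ATgt o i)
  swap
  · ext z
    rw [hY.eq _ (extMap X Y _ i z), hY.eq _ (g i z), hY.x_out _ ht, smul_zero, smul_zero]
  by_cases hs : In a b (ASrc o i)
  swap
  · ext z
    rw [hX.eq _ z, hX.x_out _ hs, smul_zero, map_zero, map_zero]
  have key : extMap X Y (fun v => η v • (φ v).smulRight (y v)) i (x (ASrc o i))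
      = g i (x (ASrc o i)) := by
    rw [hY.eq _ (g i (x (ASrc o i))), ← hη i hs ht]
    change Y.f i (η _ • φ _ (x _) • y _) - η _ • φ _ (X.f i (x _)) • y _ = _
    rw [hX.one _ hs.1 hs.2, hX.f_x i hs, one_smul, map_smul, sub_smul]
    congr 1
    · by_cases hsY : In c d (ASrc o i)
      · rw [if_pos hsY, hY.f_x i hsY]
      · rw [if_neg hsY, hY.x_out _ hsY]; simp
    · by_cases htX : In a b (ATgt o i)
      · rw [if_pos htX, hX.one _ htX.1 htX.2, one_smul]
      · rw [if_neg htX, hX.x_out _ htX]; simp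
  ext z
  rw [hX.eq _ z, map_smul, map_smul, key]

theorem potential (o : Fin n → Bool) (γ : Fin n → ℂ) (w : ℕ) : ∃ η : ℕ → ℂ, η w = 0 ∧
    ∀ i, η ((ASrc o i).val + 1) - η ((ATgt o i).val + 1) = γ i := by
  let δ : ℕ → ℂ := fun j => if h : j < n then (if o ⟨j, h⟩ then - γ ⟨j, h⟩ else γ ⟨j, h⟩) else 0
  let η₀ : ℕ → ℂ := fun k => ∑ j ∈ Finset.range (k - 1), δ j
  refine ⟨fun k => η₀ k - η₀ w, sub_self _, fun i => ?_⟩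
  have h1 : η₀ (i.val + 1 + 1) = η₀ (i.val + 1) + δ i.val := by
    simp [η₀, Finset.sum_range_succ]
  have h2 : δ i.val = if o i then - γ i else γ i := by simp [δ]
  rcases src_tgt_val o i with ⟨hs, ht, ho⟩ | ⟨hs, ht, ho⟩
  · simp only [hs, ht, h1, h2, ho]; simp
  · simp only [hs, ht, h1, h2, ho]; simp

theorem ext_zero_crit {X Y : ARep n o} {a b x φ c d y ψ} (hX : IsInt X a b x φ)
    (hY : IsInt Y c d y ψ) (w : ℕ)
    (H : ∀ i, In a b (ASrc o i) → In c d (ATgt o i) →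
      (In c d (ASrc o i) ∧ In a b (ATgt o i)) ∨
      (¬ In c d (ASrc o i) ∧ In a b (ATgt o i) ∧ (ASrc o i).val + 1 = w) ∨
      (In c d (ASrc o i) ∧ ¬ In a b (ATgt o i) ∧ (ATgt o i).val + 1 = w)) : dimExt X Y = 0 := by
  classical
  refine ext_zero_of_scalars hX hY fun γ => ?_
  obtain ⟨η, hw, hη⟩ := potential o γ w
  refine ⟨fun v => η (v.val + 1), fun i hs ht => ?_⟩
  rw [← hη i]
  rcases H i hs ht with ⟨h1, h2⟩ | ⟨h1, h2, h3⟩ | ⟨h1, h2, h3⟩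
  · simp [h1, h2]
  · simp [h1, h2, h3, hw]
  · simp [h1, h2, h3, hw]

theorem IsInt.ext_self {X : ARep n o} {a b x φ} (hX : IsInt X a b x φ) : dimExt X X = 0 :=
  ext_zero_crit hX hX 0 fun _ hs ht => Or.inl ⟨hs, ht⟩

section scalars

variable {X Y : ARep n o} {a b : ℕ} {x : ∀ v, X.M v} {φ : ∀ v, X.M v →ₗ[ℂ] ℂ} {c d : ℕ}
  {y : ∀ v, Y.M v} {ψ : ∀ v, Y.M v →ₗ[ℂ] ℂ}

theorem hom_scalar (hX : IsInt X a b x φ) (hY : IsInt Y c d y ψ) (h : ∀ v, X.M v →ₗ[ℂ] Y.M v)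
    (v : Fin (n + 1)) (z : X.M v) : h v z = (φ v z * ψ v (h v (x v))) • y v := by
  conv_lhs => rw [hX.eq v z, map_smul, hY.eq v (h v (x v)), smul_smul]

theorem hom_edge_s11 (hX : IsInt X a b x φ) (hY : IsInt Y c d y ψ) {h : ∀ v, X.M v →ₗ[ℂ] Y.M v}
    (hh : h ∈ HomSub X Y) (i : Fin n) (hs : In a b (ASrc o i)) (ht : In c d (ATgt o i)) :
    ψ _ (h _ (x (ASrc o i))) = ψ _ (h _ (x (ATgt o i))) := by
  have h1 := congrArg (ψ (ATgt o i)) (LinearMap.congr_fun (hh i) (x (ASrc o i)))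
  simp only [LinearMap.comp_apply] at h1
  rw [hX.f_x i hs] at h1
  rw [h1]
  conv_rhs => rw [hY.eq _ (h _ (x (ASrc o i))), map_smul, map_smul, smul_eq_mul]
  by_cases hsY : In c d (ASrc o i)
  · rw [hY.f_x i hsY, hY.one _ ht.1 ht.2, mul_one]
  · rw [hY.φ_out _ hsY]; simp

theorem hom_const (hX : IsInt X a b x φ) (hY : IsInt Y c d y ψ) {h : ∀ v, X.M v →ₗ[ℂ] Y.M v}
    (hh : h ∈ HomSub X Y) (k : ℕ) : ∀ (u v : Fin (n + 1)), u.val + k = v.val → In a b u → In c d u →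
    In a b v → In c d v → ψ u (h u (x u)) = ψ v (h v (x v)) := by
  induction k with
  | zero =>
    intro u v huv _ _ _ _
    have : u = v := Fin.ext (by simpa using huv)
    rw [this]
  | succ k ih =>
    intro u v huv h1 h2 h3 h4
    have hun : u.val < n := by omega
    have h5 : In a b (⟨u.val, hun⟩ : Fin n).succ := by unfold In at *; simp; omega
    have h6 : In c d (⟨u.val, hun⟩ : Fin n).succ := by unfold In at *; simp; omega
    rw [← ih (⟨u.val, hun⟩ : Fin n).succ v (by simp; omega) h5 h6 h3 h4]
    have he := hom_edge_s11 hX hY hh ⟨u.val, hun⟩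
    rcases src_tgt_val o ⟨u.val, hun⟩ with ⟨hs, ht, ho⟩ | ⟨hs, ht, ho⟩
    · have hs' : ASrc o ⟨u.val, hun⟩ = u := Fin.ext hs
      have ht' : ATgt o ⟨u.val, hun⟩ = (⟨u.val, hun⟩ : Fin n).succ := Fin.ext ht
      rw [hs', ht'] at he
      exact he h1 h6
    · have hs' : ASrc o ⟨u.val, hun⟩ = (⟨u.val, hun⟩ : Fin n).succ := Fin.ext hs
      have ht' : ATgt o ⟨u.val, hun⟩ = u := Fin.ext ht
      rw [hs', ht'] at he
      exact (he h5 h2).symm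

theorem hom_eq_zero (hX : IsInt X a b x φ) (hY : IsInt Y c d y ψ) {h : ∀ v, X.M v →ₗ[ℂ] Y.M v}
    (hh : h ∈ HomSub X Y)
    (hu : ∀ v : Fin (n + 1), In a b v → In c d v → ∃ u : Fin (n + 1), In a b u ∧ In c d u ∧ ψ u (h u (x u)) = 0) : h = 0 := by
  funext v
  ext z
  rw [hom_scalar hX hY h v z]
  by_cases h1 : In a b v
  · by_cases h2 : In c d v
    · obtain ⟨u, h3, h4, h5⟩ := hu v h1 h2
      have : ψ v (h v (x v)) = 0 := by
        rcases le_total u.val v.val with hle | hle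
        · rw [← hom_const hX hY hh (v.val - u.val) u v (by omega) h3 h4 h1 h2, h5]
        · rw [hom_const hX hY hh (u.val - v.val) v u (by omega) h1 h2 h3 h4, h5]
      rw [this]; simp
    · rw [hY.x_out v h2]; simp
  · rw [hX.φ_out v h1]; simp

theorem dimHom_eq_zero_iff (X Y : ARep n o) : dimHom X Y = 0 ↔ ∀ h ∈ HomSub X Y, h = 0 := by
  unfold dimHom
  rw [Submodule.finrank_eq_zero, Submodule.eq_bot_iff]

theorem dimHom_le_one (hX : IsInt X a b x φ) (hY : IsInt Y c d y ψ) : dimHom X Y ≤ 1 := by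
  by_cases hu : ∃ u : Fin (n + 1), In a b u ∧ In c d u
  · obtain ⟨u, h1, h2⟩ := hu
    let T : HomSub X Y →ₗ[ℂ] ℂ :=
      { toFun := fun h => ψ u (h.1 u (x u))
        map_add' := by intros; simp
        map_smul' := by intros; simp }
    have hT : Function.Injective T := by
      rw [injective_iff_map_eq_zero]
      intro h hz
      exact Subtype.ext (hom_eq_zero hX hY h.2 fun v _ _ => ⟨u, h1, h2, hz⟩)
    have := LinearMap.finrank_le_finrank_of_injective hT
    rw [Module.finrank_self] at this
    exact this
  · have : dimHom X Y = 0 := by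
      rw [dimHom_eq_zero_iff]
      intro h hh
      exact hom_eq_zero hX hY hh fun v h1 h2 => absurd ⟨v, h1, h2⟩ hu
    omega

/-- If `Ext¹(X,Y) ≠ 0` then there are two counted edges avoiding the left, resp. right, anchor. -/
theorem exists_edge (hX : IsInt X a b x φ) (hY : IsInt Y c d y ψ) (hne : dimExt X Y ≠ 0) (w : ℕ) :
    ∃ i, In a b (ASrc o i) ∧ In c d (ATgt o i) ∧ ¬ (In c d (ASrc o i) ∧ In a b (ATgt o i)) ∧
      ¬ (¬ In c d (ASrc o i) ∧ In a b (ATgt o i) ∧ (ASrc o i).val + 1 = w) ∧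
      ¬ (In c d (ASrc o i) ∧ ¬ In a b (ATgt o i) ∧ (ATgt o i).val + 1 = w) := by
  by_contra hcon
  refine hne (ext_zero_crit hX hY w fun i hs ht => ?_)
  by_contra h2
  exact hcon ⟨i, hs, ht, by tauto, by tauto, by tauto⟩

theorem hom_zero_of_ext (hX : IsInt X a b x φ) (hY : IsInt Y c d y ψ) (hne : dimExt X Y ≠ 0) :
    dimHom X Y = 0 := by
  rw [dimHom_eq_zero_iff]
  intro h hh
  refine hom_eq_zero hX hY hh fun v hv1 hv2 => ?_
  obtain ⟨i, hs, ht, h1, -, -⟩ := exists_edge hX hY hne 0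
  have he := hom_edge_s11 hX hY hh i hs ht
  have hst := src_tgt_val o i
  by_cases h2 : In c d (ASrc o i)
  · refine ⟨_, hs, h2, ?_⟩
    rw [he, hX.x_out (ATgt o i) (fun h3 => h1 ⟨h2, h3⟩)]; simp
  · by_cases h3 : In a b (ATgt o i)
    · refine ⟨_, h3, ht, ?_⟩
      rw [← he, hY.φ_out _ h2]; simp
    · exfalso
      unfold In at *
      omega

theorem ext_zero_of_ext (hX : IsInt X a b x φ) (hY : IsInt Y c d y ψ) (hne : dimExt X Y ≠ 0) :
    dimExt Y X = 0 := by
  refine ext_zero_crit hY hX 0 fun j hs ht => Or.inl ?_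
  by_contra hcon
  obtain ⟨i, h1, h2, h3, h4, h5⟩ := exists_edge hX hY hne (max a c)
  obtain ⟨k, g1, g2, g3, g4, g5⟩ := exists_edge hX hY hne (min b d + 1 + 1)
  have hst := src_tgt_val o i
  have hst' := src_tgt_val o j
  have hst'' := src_tgt_val o k
  have e1 : i.val = j.val → (ASrc o i).val = (ASrc o j).val := fun h => by rw [Fin.ext h]
  have e2 : k.val = j.val → (ASrc o k).val = (ASrc o j).val := fun h => by rw [Fin.ext h]
  have e3 : k.val = i.val → (ASrc o k).val = (ASrc o i).val := fun h => by rw [Fin.ext h]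
  have := hX.hab
  have := hY.hab
  unfold In at *
  generalize (ASrc o i).val = si at *
  generalize (ATgt o i).val = ti at *
  generalize (ASrc o j).val = sj at *
  generalize (ATgt o j).val = tj at *
  generalize (ASrc o k).val = sk at *
  generalize (ATgt o k).val = tk at *
  generalize i.val = i' at *
  generalize j.val = j' at *
  generalize k.val = k' at *
  rcases hst with ⟨rfl, rfl, -⟩ | ⟨rfl, rfl, -⟩ <;> rcases hst' with ⟨rfl, rfl, -⟩ | ⟨rfl, rfl, -⟩ <;>
  rcases hst'' with ⟨rfl, rfl, -⟩ | ⟨rfl, rfl, -⟩ <;> omega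

end scalars

/-! ### Diagram chases -/

theorem extMap_apply (X Y : ARep n o) (h : ∀ v, X.M v →ₗ[ℂ] Y.M v) (i : Fin n)
    (z : X.M (ASrc o i)) : extMap X Y h i z = Y.f i (h _ z) - h _ (X.f i z) := rfl

/-- A short exact sequence with vertexwise linear splittings. -/
structure Spl (L F E : ARep n o) (ι : ∀ v, L.M v →ₗ[ℂ] F.M v) (p : ∀ v, F.M v →ₗ[ℂ] E.M v)
    (ρ : ∀ v, F.M v →ₗ[ℂ] L.M v) (σ : ∀ v, E.M v →ₗ[ℂ] F.M v) : Prop where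
  ρι : ∀ v x, ρ v (ι v x) = x
  pσ : ∀ v x, p v (σ v x) = x
  pι : ∀ v x, p v (ι v x) = 0
  ρσ : ∀ v x, ρ v (σ v x) = 0
  dec : ∀ v x, ι v (ρ v x) + σ v (p v x) = x
  ιf : ∀ i x, ι (ATgt o i) (L.f i x) = F.f i (ι (ASrc o i) x)
  pf : ∀ i x, p (ATgt o i) (F.f i x) = E.f i (p (ASrc o i) x)

section chase

variable {L E F : ARep n o} {ι : ∀ v, L.M v →ₗ[ℂ] F.M v} {p : ∀ v, F.M v →ₗ[ℂ] E.M v}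
    {ρ : ∀ v, F.M v →ₗ[ℂ] L.M v} {σ : ∀ v, E.M v →ₗ[ℂ] F.M v}

theorem exists_spl (hι : ι ∈ HomSub L F)
    (hinj : ∀ v, Function.Injective (ι v)) (hp : p ∈ HomSub F E)
    (hsurj : ∀ v, Function.Surjective (p v))
    (hexact : ∀ v, LinearMap.range (ι v) = LinearMap.ker (p v)) : ∃ ρ σ, Spl L F E ι p ρ σ := by
  choose ρ hρ using fun v =>
    LinearMap.exists_leftInverse_of_injective (ι v) (LinearMap.ker_eq_bot.2 (hinj v))
  choose σ hσ using fun v =>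
    LinearMap.exists_rightInverse_of_surjective (p v) (LinearMap.range_eq_top.2 (hsurj v))
  have ρι : ∀ v x, ρ v (ι v x) = x := fun v x => LinearMap.congr_fun (hρ v) x
  have pσ : ∀ v x, p v (σ v x) = x := fun v x => LinearMap.congr_fun (hσ v) x
  have pι : ∀ v x, p v (ι v x) = 0 := fun v x => by
    have : ι v x ∈ LinearMap.ker (p v) := hexact v ▸ LinearMap.mem_range_self _ x
    exact this
  refine ⟨ρ, fun v => σ v - (ι v).comp ((ρ v).comp (σ v)), ρι, ?_, pι, ?_, ?_, ?_, ?_⟩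
  · intro v x; simp [pσ, pι]
  · intro v x; simp [ρι]
  · intro v x
    have : x - σ v (p v x) ∈ LinearMap.ker (p v) := by simp [pσ]
    rw [← hexact] at this
    obtain ⟨w, hw⟩ := this
    have h2 : x = ι v w + σ v (p v x) := by rw [hw]; simp
    have h3 : ρ v x = w + ρ v (σ v (p v x)) := by
      conv_lhs => rw [h2, map_add, ρι]
    simp only [LinearMap.sub_apply, LinearMap.comp_apply, h3, map_add]
    rw [hw]; abel
  · intro i x; exact LinearMap.congr_fun (hι i) x
  · intro i x; exact LinearMap.congr_fun (hp i) x

theorem Spl.ext_right (S : Spl L F E ι p ρ σ) {X : ARep n o} (h0 : dimExt X E = 0)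
    (hyp : ∀ g : ∀ i, X.M (ASrc o i) →ₗ[ℂ] L.M (ATgt o i), ∃ h : ∀ v, X.M v →ₗ[ℂ] F.M v,
      ∀ i z, extMap X F h i z = ι _ (g i z)) : dimExt X F = 0 := by
  rw [dimExt_eq_zero_iff] at *
  intro g
  obtain ⟨u, hu⟩ := h0 (fun i => (p _).comp (g i))
  obtain ⟨h, hh⟩ := hyp (fun i => (ρ _).comp (g i - extMap X F (fun v => (σ v).comp (u v)) i))
  refine ⟨h + fun v => (σ v).comp (u v), ?_⟩
  funext i
  ext z
  rw [map_add, Pi.add_apply, LinearMap.add_apply, hh]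
  have h1 : p _ ((g i - extMap X F (fun v => (σ v).comp (u v)) i) z) = 0 := by
    have := LinearMap.congr_fun (congrFun hu i) z
    rw [extMap_apply, LinearMap.comp_apply] at this
    rw [LinearMap.sub_apply, map_sub, extMap_apply, map_sub, S.pf, LinearMap.comp_apply,
      LinearMap.comp_apply, S.pσ, S.pσ, this, sub_self]
  have h2 := S.dec _ ((g i - extMap X F (fun v => (σ v).comp (u v)) i) z)
  rw [h1, map_zero, add_zero] at h2
  rw [LinearMap.comp_apply, h2, LinearMap.sub_apply, sub_add_cancel]

theorem Spl.ext_left (S : Spl L F E ι p ρ σ) {Y : ARep n o} (h0 : dimExt L Y = 0)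
    (hyp : ∀ g : ∀ i, E.M (ASrc o i) →ₗ[ℂ] Y.M (ATgt o i), ∃ h : ∀ v, F.M v →ₗ[ℂ] Y.M v,
      ∀ i z, extMap F Y h i z = g i (p _ z)) : dimExt F Y = 0 := by
  rw [dimExt_eq_zero_iff] at *
  intro g
  obtain ⟨u, hu⟩ := h0 (fun i => (g i).comp (ι _))
  obtain ⟨h, hh⟩ := hyp (fun i => (g i - extMap F Y (fun v => (u v).comp (ρ v)) i).comp (σ _))
  refine ⟨h + fun v => (u v).comp (ρ v), ?_⟩
  funext i
  ext z
  rw [map_add, Pi.add_apply, LinearMap.add_apply, hh]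
  have h1 : ∀ w, (g i - extMap F Y (fun v => (u v).comp (ρ v)) i) (ι _ w) = 0 := by
    intro w
    have := LinearMap.congr_fun (congrFun hu i) w
    rw [extMap_apply, LinearMap.comp_apply] at this
    rw [LinearMap.sub_apply, extMap_apply, ← S.ιf, LinearMap.comp_apply,
      LinearMap.comp_apply, S.ρι, S.ρι, this, sub_self]
  have h2 := congrArg (g i - extMap F Y (fun v => (u v).comp (ρ v)) i) (S.dec _ z)
  rw [map_add, h1, zero_add] at h2
  rw [LinearMap.comp_apply, h2, LinearMap.sub_apply, sub_add_cancel]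

/-- The identity `ι c = ∂σ` for the extension cocycle `c = ρ f σ`. -/
theorem Spl.cocycle (S : Spl L F E ι p ρ σ) (i : Fin n) (e : E.M (ASrc o i)) :
    ι _ (ρ _ (F.f i (σ _ e))) = F.f i (σ _ e) - σ _ (E.f i e) := by
  have := S.dec _ (F.f i (σ _ e))
  rw [S.pf, S.pσ] at this
  rw [eq_sub_iff_add_eq, this]

theorem Spl.classes (S : Spl L F E ι p ρ σ) (hext : dimExt E L = 1)
    (hns : ¬ ∃ s ∈ HomSub E F, ∀ v, (p v).comp (s v) = LinearMap.id)
    (g : ∀ i, E.M (ASrc o i) →ₗ[ℂ] L.M (ATgt o i)) :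
    ∃ (t : ℂ) (h : ∀ v, E.M v →ₗ[ℂ] L.M v), ∀ i z,
      g i z = t • ρ _ (F.f i (σ _ z)) + extMap E L h i z := by
  set c : ∀ i, E.M (ASrc o i) →ₗ[ℂ] L.M (ATgt o i) := fun i => (ρ _).comp ((F.f i).comp (σ _))
    with hc
  have hc0 : (LinearMap.range (extMap E L)).mkQ c ≠ 0 := by
    intro h0
    rw [Submodule.mkQ_apply, Submodule.Quotient.mk_eq_zero] at h0
    obtain ⟨h, hh⟩ := h0
    apply hns
    refine ⟨fun v => σ v - (ι v).comp (h v), ?_, ?_⟩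
    · intro i
      ext e
      have h1 := congrArg (ι _) (LinearMap.congr_fun (congrFun hh i) e)
      rw [extMap_apply] at h1
      simp only [hc, LinearMap.comp_apply] at h1
      rw [S.cocycle, map_sub, S.ιf] at h1
      simp only [LinearMap.comp_apply, LinearMap.sub_apply, map_sub]
      rw [sub_eq_sub_iff_add_eq_add] at h1 ⊢
      rw [add_comm, h1, add_comm]
    · intro v
      ext e
      simp [S.pσ, S.pι]
  obtain ⟨t, ht⟩ := (finrank_eq_one_iff_of_nonzero' _ hc0).1 hext
    ((LinearMap.range (extMap E L)).mkQ g)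
  rw [← map_smul, ← sub_eq_zero, ← map_sub, Submodule.mkQ_apply,
    Submodule.Quotient.mk_eq_zero] at ht
  obtain ⟨h, hh⟩ := ht
  refine ⟨t, -h, fun i z => ?_⟩
  have := LinearMap.congr_fun (congrFun hh i) z
  rw [map_neg, Pi.neg_apply, LinearMap.neg_apply, this]
  simp [hc]

theorem Spl.ext_FL (S : Spl L F E ι p ρ σ) (hext : dimExt E L = 1)
    (hns : ¬ ∃ s ∈ HomSub E F, ∀ v, (p v).comp (s v) = LinearMap.id)
    (hLL : dimExt L L = 0) : dimExt F L = 0 := by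
  refine S.ext_left hLL fun g => ?_
  obtain ⟨t, h, hh⟩ := S.classes hext hns g
  refine ⟨fun v => (h v).comp (p v) - t • ρ v, fun i z => ?_⟩
  rw [hh, extMap_apply, extMap_apply]
  have h1 := S.dec _ z
  have h2 : σ _ (p _ z) = z - ι _ (ρ _ z) := by rw [← h1]; simp [S.ρι, S.ρσ, S.pσ, S.pι]
  rw [h2, map_sub (F.f i), ← S.ιf, map_sub, S.ρι]
  simp only [LinearMap.comp_apply, LinearMap.sub_apply, LinearMap.smul_apply, map_sub, map_smul,
    S.pf, smul_sub]
  abel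

theorem Spl.ext_EF (S : Spl L F E ι p ρ σ) (hext : dimExt E L = 1)
    (hns : ¬ ∃ s ∈ HomSub E F, ∀ v, (p v).comp (s v) = LinearMap.id)
    (hEE : dimExt E E = 0) : dimExt E F = 0 := by
  refine S.ext_right hEE fun g => ?_
  obtain ⟨t, h, hh⟩ := S.classes hext hns g
  refine ⟨fun v => (ι v).comp (h v) + t • σ v, fun i z => ?_⟩
  rw [hh, extMap_apply, extMap_apply, map_add, map_smul, S.cocycle]
  simp only [LinearMap.comp_apply, LinearMap.add_apply, LinearMap.smul_apply, map_sub, map_add,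
    map_smul, S.ιf, smul_sub]
  abel

theorem Spl.ext_FF (S : Spl L F E ι p ρ σ) (hEF : dimExt E F = 0) (hLL : dimExt L L = 0) (hLE : dimExt L E = 0) :
    dimExt F F = 0 := by
  have hLF : dimExt L F = 0 := by
    refine S.ext_right hLE fun g => ?_
    obtain ⟨h, hh⟩ := (dimExt_eq_zero_iff _ _).1 hLL g
    refine ⟨fun v => (ι v).comp (h v), fun i z => ?_⟩
    rw [← hh, extMap_apply, extMap_apply, map_sub, S.ιf]
    rfl
  refine S.ext_left hLF fun g => ?_
  obtain ⟨h, hh⟩ := (dimExt_eq_zero_iff _ _).1 hEF g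
  refine ⟨fun v => (h v).comp (p v), fun i z => ?_⟩
  rw [← hh, extMap_apply, extMap_apply, ← S.pf]
  rfl

theorem Spl.finrank (S : Spl L F E ι p ρ σ) (v : Fin (n + 1)) :
    Module.finrank ℂ (F.M v) = Module.finrank ℂ (L.M v) + Module.finrank ℂ (E.M v) := by
  rw [← Module.finrank_prod]
  refine LinearEquiv.finrank_eq
    (LinearEquiv.ofLinearMap ((ρ v).prod (p v)) ((ι v).coprod (σ v)) ?_ ?_)
  · ext x <;> simp [S.ρι, S.ρσ, S.pσ, S.pι]
  · ext x
    simp [S.dec]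

theorem Spl.euler (S : Spl L F E ι p ρ σ) : (dimHom F F : ℤ) - dimExt F F =
    ((dimHom L L : ℤ) - dimExt L L) + ((dimHom E E : ℤ) - dimExt E E) +
    ((dimHom L E : ℤ) - dimExt L E) + ((dimHom E L : ℤ) - dimExt E L) := by
  simp only [ARep.euler, S.finrank, Nat.cast_add, add_mul, mul_add, Finset.sum_add_distrib]
  ring

end chase

theorem id_mem (X : ARep n o) : (fun _ => LinearMap.id) ∈ HomSub X X := fun _ => rfl

theorem Indecomposable.dimHom_self {X : ARep n o} (hX : X.Indecomposable) : dimHom X X = 1 := by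
  obtain ⟨a, b, x, φ, h⟩ := hX.isInt
  have h1 := dimHom_le_one h h
  have h2 : dimHom X X ≠ 0 := by
    rw [Ne, dimHom_eq_zero_iff]
    intro h0
    obtain ⟨v, z, hz⟩ := hX.1
    have := congrFun (h0 _ (id_mem X)) v
    exact hz (LinearMap.congr_fun this z)
  omega

theorem indecomposable_of_dimHom {X : ARep n o} (hne : ∃ v, ∃ x : X.M v, x ≠ 0)
    (h1 : dimHom X X = 1) : X.Indecomposable := by
  refine ⟨hne, fun e he hidem => ?_⟩
  obtain ⟨v, z, hz⟩ := hne
  have hid0 : (⟨_, id_mem X⟩ : HomSub X X) ≠ 0 := by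
    intro h0
    have := congrFun (congrArg Subtype.val h0) v
    exact hz (LinearMap.congr_fun this z)
  obtain ⟨t, ht⟩ := (finrank_eq_one_iff_of_nonzero' _ hid0).1 h1 ⟨e, he⟩
  have hte : ∀ v w, e v w = t • w := fun v w => by
    have := LinearMap.congr_fun (congrFun (congrArg Subtype.val ht) v) w
    exact this.symm
  have h2 := LinearMap.congr_fun (hidem v) z
  rw [LinearMap.comp_apply, hte, hte, smul_smul, ← sub_eq_zero, ← sub_smul, smul_eq_zero] at h2
  have h3 : t * (t - 1) = 0 := by
    have := h2.resolve_right hz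
    linear_combination this
  rcases mul_eq_zero.1 h3 with h | h
  · left; funext v; ext w; rw [hte, h]; simp
  · right; funext v; ext w; rw [hte, sub_eq_zero.1 h]; simp

theorem no_three {F : ARep n o} (hF : dimHom F F ≤ 2) : 
    ¬ ∃ e₁ e₂ e₃ : ∀ v, F.M v →ₗ[ℂ] F.M v,
        e₁ ∈ HomSub F F ∧ e₂ ∈ HomSub F F ∧ e₃ ∈ HomSub F F ∧
        (∀ v, (e₁ v).comp (e₁ v) = e₁ v) ∧
        (∀ v, (e₂ v).comp (e₂ v) = e₂ v) ∧
        (∀ v, (e₃ v).comp (e₃ v) = e₃ v) ∧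
        (∀ v, (e₁ v).comp (e₂ v) = 0) ∧ (∀ v, (e₂ v).comp (e₁ v) = 0) ∧
        (∀ v, (e₁ v).comp (e₃ v) = 0) ∧ (∀ v, (e₃ v).comp (e₁ v) = 0) ∧
        (∀ v, (e₂ v).comp (e₃ v) = 0) ∧ (∀ v, (e₃ v).comp (e₂ v) = 0) ∧
        e₁ + e₂ + e₃ = (fun _ => LinearMap.id) ∧
        e₁ ≠ 0 ∧ e₂ ≠ 0 ∧ e₃ ≠ 0 := by
  rintro ⟨e₁, e₂, e₃, m1, m2, m3, i1, i2, i3, h12, h21, h13, h31, h23, h32, -, n1, n2, n3⟩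
  have hz : ∀ (t : ℂ) (e : ∀ v, F.M v →ₗ[ℂ] F.M v), e ≠ 0 → (∀ v, t • e v = 0) → t = 0 := by
    intro t e hne h
    by_contra ht
    exact hne (funext fun v => (smul_eq_zero.1 (h v)).resolve_left ht)
  have hli : LinearIndependent ℂ ![(⟨e₁, m1⟩ : HomSub F F), ⟨e₂, m2⟩, ⟨e₃, m3⟩] := by
    rw [Fintype.linearIndependent_iff]
    intro g hg
    rw [Fin.sum_univ_three] at hg
    have hg' : ∀ v, g 0 • e₁ v + g 1 • e₂ v + g 2 • e₃ v = 0 := fun v =>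
      congrFun (congrArg Subtype.val hg) v
    have a0 : g 0 = 0 := hz _ e₁ n1 fun v => by
      have := congrArg (fun q => (e₁ v).comp q) (hg' v)
      simpa [LinearMap.comp_add, LinearMap.comp_smul, i1, h12, h13] using this
    have a1 : g 1 = 0 := hz _ e₂ n2 fun v => by
      have := congrArg (fun q => (e₂ v).comp q) (hg' v)
      simpa [LinearMap.comp_add, LinearMap.comp_smul, i2, h21, h23] using this
    have a2 : g 2 = 0 := hz _ e₃ n3 fun v => by
      have := congrArg (fun q => (e₃ v).comp q) (hg' v)
      simpa [LinearMap.comp_add, LinearMap.comp_smul, i3, h31, h32] using this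
    intro i
    fin_cases i
    · exact a0
    · exact a1
    · exact a2
  have := hli.fintype_card_le_finrank
  simp only [Fintype.card_fin] at this
  unfold dimHom at hF
  omega

end ARep

open ARep in
/-- Let `L`, `E` be indecomposable representations of a type `A` quiver
with `dim Ext¹(E,L) = 1`, and let `0 → L → F → E → 0` be a non-split short exact sequence.
Then: (a) `F` is rigid (`Ext¹(F,F) = 0`); (b) `F` has at most two indecomposable direct
summands (no three nonzero pairwise orthogonal idempotent endomorphisms summing to the
identity); (c) `F` is indecomposable iff `Hom(L,E) = 0`; (d) `Ext¹(F,L) = 0` and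
`Ext¹(E,F) = 0`. -/
theorem ARep.middle_term_properties
    {n : ℕ} {o : Fin n → Bool} (L E F : ARep n o)
    (hL : L.Indecomposable) (hE : E.Indecomposable)
    (hext : dimExt E L = 1)
    (ι : ∀ v, L.M v →ₗ[ℂ] F.M v) (hι : ι ∈ HomSub L F)
    (hinj : ∀ v, Function.Injective (ι v))
    (p : ∀ v, F.M v →ₗ[ℂ] E.M v) (hp : p ∈ HomSub F E)
    (hsurj : ∀ v, Function.Surjective (p v))
    (hexact : ∀ v, LinearMap.range (ι v) = LinearMap.ker (p v))
    (hnonsplit : ¬ ∃ s ∈ HomSub E F, ∀ v, (p v).comp (s v) = LinearMap.id) :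
    dimExt F F = 0 ∧
    (¬ ∃ e₁ e₂ e₃ : ∀ v, F.M v →ₗ[ℂ] F.M v,
        e₁ ∈ HomSub F F ∧ e₂ ∈ HomSub F F ∧ e₃ ∈ HomSub F F ∧
        (∀ v, (e₁ v).comp (e₁ v) = e₁ v) ∧
        (∀ v, (e₂ v).comp (e₂ v) = e₂ v) ∧
        (∀ v, (e₃ v).comp (e₃ v) = e₃ v) ∧
        (∀ v, (e₁ v).comp (e₂ v) = 0) ∧ (∀ v, (e₂ v).comp (e₁ v) = 0) ∧
        (∀ v, (e₁ v).comp (e₃ v) = 0) ∧ (∀ v, (e₃ v).comp (e₁ v) = 0) ∧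
        (∀ v, (e₂ v).comp (e₃ v) = 0) ∧ (∀ v, (e₃ v).comp (e₂ v) = 0) ∧
        e₁ + e₂ + e₃ = (fun _ => LinearMap.id) ∧
        e₁ ≠ 0 ∧ e₂ ≠ 0 ∧ e₃ ≠ 0) ∧
    (F.Indecomposable ↔ dimHom L E = 0) ∧
    (dimExt F L = 0 ∧ dimExt E F = 0) := by
  obtain ⟨ρ, σ, S⟩ := exists_spl hι hinj hp hsurj hexact
  obtain ⟨a, b, x, φ, iL⟩ := hL.isInt
  obtain ⟨c, d, y, ψ, iE⟩ := hE.isInt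
  have hne : dimExt E L ≠ 0 := by omega
  have hLL := iL.ext_self
  have hEE := iE.ext_self
  have hLE := ext_zero_of_ext iE iL hne
  have hhEL := hom_zero_of_ext iE iL hne
  have hhLE := dimHom_le_one iL iE
  have hFL := S.ext_FL hext hnonsplit hLL
  have hEF := S.ext_EF hext hnonsplit hEE
  have hFF := S.ext_FF hEF hLL hLE
  have heul := S.euler
  have h1 := hL.dimHom_self
  have h2 := hE.dimHom_self
  have hdim : dimHom F F = 1 + dimHom L E := by omega
  refine ⟨hFF, no_three (by omega), ⟨fun h => ?_, fun h => ?_⟩, hFL, hEF⟩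
  · have := h.dimHom_self
    omega
  · refine indecomposable_of_dimHom ?_ (by omega)
    obtain ⟨v, z, hz⟩ := hL.1
    exact ⟨v, ι v z, fun h0 => hz (hinj v (by rw [h0, map_zero]))⟩
end

section
/- Let Q be a quiver of type A_n with the anti-involution σ(i) = n+1−i, and let ∇ be the induced twisted duality on representations. If n is odd, then for every indecomposable representation L, every homomorphism f : L → ∇L satisfies ∇f = f; if n is even, every such f satisfies ∇f = −f. Consequently, if (Q,ε) is of split type (ε = −1 for n odd, ε = +1 for n even), then Hom(L,∇L)^{ε∇} = 0 for every indecomposable L. -/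
namespace ARepAux

section lin
variable {V W : Type} [AddCommGroup V] [Module ℂ V] [FiniteDimensional ℂ V]
  [AddCommGroup W] [Module ℂ W] [FiniteDimensional ℂ W]

theorem exists_rankone (F : Set (Submodule ℂ V)) (hF : IsChain (· ≤ ·) F)
    (R : Submodule ℂ V) (hR : R ≠ ⊥) :
    ∃ x ∈ R, ∃ l : V →ₗ[ℂ] ℂ, l x = 1 ∧ ∀ S ∈ F, x ∈ S ∨ ∀ y ∈ S, l y = 0 := by
  obtain ⟨S0, ⟨hS0F, hS0⟩, hmin⟩ := (wellFounded_lt (α := Submodule ℂ V)).has_min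
    {S | (S = ⊤ ∨ S ∈ F) ∧ S ⊓ R ≠ ⊥} ⟨⊤, Or.inl rfl, by simpa using hR⟩
  obtain ⟨x, hx, hx0⟩ := Submodule.exists_mem_ne_zero_of_ne_bot hS0
  obtain ⟨S1, ⟨hS1F, hS1⟩, hmax⟩ := (wellFounded_gt (α := Submodule ℂ V)).has_min
    {S | (S = ⊥ ∨ S ∈ F) ∧ S ⊓ R = ⊥} ⟨⊥, Or.inl rfl, by simp⟩
  have hxS1 : x ∉ S1 := fun h => hx0 (by
    have : x ∈ S1 ⊓ R := ⟨h, hx.2⟩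
    rw [hS1] at this; simpa using this)
  obtain ⟨l, hl, hl1⟩ := Submodule.exists_le_ker_of_notMem hxS1
  refine ⟨x, hx.2, (l x)⁻¹ • l, by simp [hl], fun S hS => ?_⟩
  by_cases h : S ⊓ R = ⊥
  · right
    intro y hy
    have hle : S ≤ S1 := by
      rcases hS1F with rfl | hS1F
      · by_contra hn
        exact hmax S ⟨Or.inr hS, h⟩ (bot_lt_iff_ne_bot.2 (fun h => hn h.le))
      · rcases hF.total hS hS1F with h1 | h1
        · exact h1
        · by_contra hn
          exact hmax S ⟨Or.inr hS, h⟩ (lt_of_le_not_ge h1 hn)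
    have := hl1 (hle hy)
    simp only [LinearMap.mem_ker] at this
    simp [this]
  · left
    have hle : S0 ≤ S := by
      rcases hS0F with rfl | hS0F
      · by_contra hn
        exact hmin S ⟨Or.inr hS, h⟩ (lt_top_iff_ne_top.2 (fun h => hn h.ge))
      · rcases hF.total hS0F hS with h1 | h1
        · exact h1
        · by_contra hn
          exact hmin S ⟨Or.inr hS, h⟩ (lt_of_le_not_ge h1 hn)
    exact hle hx.1

def Pres (F : Set (Submodule ℂ V)) (φ : V →ₗ[ℂ] V) : Prop := ∀ S ∈ F, ∀ x ∈ S, φ x ∈ S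

theorem exists_proj (F : Set (Submodule ℂ V)) (hF : IsChain (· ≤ ·) F) :
    ∀ (k : ℕ) (R : Submodule ℂ V), Module.finrank ℂ R = k →
      ∃ p : V →ₗ[ℂ] V, Pres F p ∧ (∀ x, p x ∈ R) ∧ ∀ x ∈ R, p x = x := by
  intro k
  induction k using Nat.strong_induction_on with
  | _ k ih =>
    intro R hk
    by_cases hR : R = ⊥
    · subst hR
      exact ⟨0, fun S _ x _ => by simp, by simp, by simp⟩
    obtain ⟨x, hxR, l, hlx, hS⟩ := exists_rankone F hF R hR
    have hlt : R ⊓ LinearMap.ker l < R := by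
      refine lt_of_le_of_ne inf_le_left fun h => ?_
      have : x ∈ R ⊓ LinearMap.ker l := by rw [h]; exact hxR
      have h2 := this.2
      simp [hlx] at h2
    obtain ⟨p, hp1, hp2, hp3⟩ := ih _ (hk ▸ Submodule.finrank_lt_finrank_of_lt hlt) _ rfl
    have key : ∀ S ∈ F, ∀ y ∈ S, l y • x ∈ S := by
      intro S hSF y hy
      rcases hS S hSF with h | h
      · exact S.smul_mem _ h
      · simp [h y hy]
    refine ⟨p ∘ₗ (LinearMap.id - l.smulRight x) + l.smulRight x, ?_, ?_, ?_⟩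
    · intro S hSF y hy
      simp only [LinearMap.add_apply, LinearMap.comp_apply, LinearMap.sub_apply,
        LinearMap.id_apply, LinearMap.smulRight_apply]
      exact S.add_mem (hp1 S hSF _ (S.sub_mem hy (key S hSF y hy))) (key S hSF y hy)
    · intro y
      simp only [LinearMap.add_apply, LinearMap.comp_apply, LinearMap.sub_apply,
        LinearMap.id_apply, LinearMap.smulRight_apply]
      exact R.add_mem (hp2 _).1 (R.smul_mem _ hxR)
    · intro y hy
      simp only [LinearMap.add_apply, LinearMap.comp_apply, LinearMap.sub_apply,
        LinearMap.id_apply, LinearMap.smulRight_apply]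
      rw [hp3 _ ⟨R.sub_mem hy (R.smul_mem _ hxR), by simp [hlx]⟩]
      simp

theorem exists_pinv (f : V →ₗ[ℂ] W) : ∃ g : W →ₗ[ℂ] V, ∀ x, f (g (f x)) = f x := by
  obtain ⟨s, hs⟩ := f.rangeRestrict.exists_rightInverse_of_surjective
    (LinearMap.range_eq_top.2 f.surjective_rangeRestrict)
  obtain ⟨g, hg⟩ := LinearMap.exists_extend s
  refine ⟨g, fun x => ?_⟩
  have h1 : g (f x) = s (f.rangeRestrict x) := by
    rw [← hg]; rfl
  have h2 := congrArg Subtype.val (LinearMap.congr_fun hs (f.rangeRestrict x))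
  rw [h1]
  exact h2

/-- Good chain data. -/
def Good (F : Set (Submodule ℂ V)) : Prop := IsChain (· ≤ ·) F ∧ ⊥ ∈ F ∧ ⊤ ∈ F

theorem step_fwd (f : V →ₗ[ℂ] W) (F : Set (Submodule ℂ V)) (hF : Good F) :
    ∃ G : Set (Submodule ℂ W), Good G ∧ ∀ φ : W →ₗ[ℂ] W, Pres G φ → (∀ x, φ (φ x) = φ x) →
      ∃ ψ : V →ₗ[ℂ] V, Pres F ψ ∧ (∀ x, ψ (ψ x) = ψ x) ∧ ∀ x, φ (f x) = f (ψ x) := by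
  obtain ⟨p, hp1, hp2, hp3⟩ := exists_proj F hF.1 _ (LinearMap.ker f) rfl
  obtain ⟨g, hg⟩ := exists_pinv f
  refine ⟨insert ⊤ (Submodule.map f '' F), ⟨?_, ?_, ?_⟩, ?_⟩
  · refine IsChain.insert ?_ (fun _ _ _ => Or.inr le_top)
    rintro _ ⟨S, hS, rfl⟩ _ ⟨T, hT, rfl⟩ _
    rcases hF.1.total hS hT with h | h
    · exact Or.inl (Submodule.map_mono h)
    · exact Or.inr (Submodule.map_mono h)
  · exact Or.inr ⟨⊥, hF.2.1, by simp⟩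
  · exact Or.inl rfl
  intro φ hφ hid
  have hfp : ∀ x, f (p x) = 0 := fun x => hp2 x
  have hφf : ∀ S ∈ F, ∀ x ∈ S, ∃ y ∈ S, f y = φ (f x) := fun S hS x hx =>
    hφ _ (Or.inr ⟨S, hS, rfl⟩) (f x) ⟨x, hx, rfl⟩
  have hfg : ∀ x, f (g (φ (f x))) = φ (f x) := by
    intro x
    obtain ⟨y, -, hy⟩ := hφf ⊤ hF.2.2 x trivial
    rw [← hy, hg]
  have hfψ : ∀ x, f (((LinearMap.id - p) ∘ₗ g ∘ₗ φ ∘ₗ f) x) = φ (f x) := by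
    intro x
    simp [hfp, hfg]
  refine ⟨(LinearMap.id - p) ∘ₗ g ∘ₗ φ ∘ₗ f, ?_, ?_, fun x => (hfψ x).symm⟩
  · intro S hS x hx
    obtain ⟨y, hyS, hy⟩ := hφf S hS x hx
    have h1 : p (g (f y) - y) = g (f y) - y := hp3 _ (by simp [hg])
    have h2 : ((LinearMap.id - p) ∘ₗ g ∘ₗ φ ∘ₗ f) x = y - p y := by
      simp only [LinearMap.comp_apply, LinearMap.sub_apply, LinearMap.id_apply, ← hy]
      rw [map_sub] at h1
      rw [sub_eq_sub_iff_sub_eq_sub, ← h1]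
    rw [h2]
    exact S.sub_mem hyS (hp1 S hS y hyS)
  · intro x
    have h := hfψ x
    generalize hz : ((LinearMap.id - p) ∘ₗ g ∘ₗ φ ∘ₗ f) x = z at h ⊢
    simp only [LinearMap.comp_apply] at hz ⊢
    rw [h, hid, hz]

theorem step_bwd (f : W →ₗ[ℂ] V) (F : Set (Submodule ℂ V)) (hF : Good F) :
    ∃ G : Set (Submodule ℂ W), Good G ∧ ∀ φ : W →ₗ[ℂ] W, Pres G φ → (∀ x, φ (φ x) = φ x) →
      ∃ ψ : V →ₗ[ℂ] V, Pres F ψ ∧ (∀ x, ψ (ψ x) = ψ x) ∧ ∀ x, ψ (f x) = f (φ x) := by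
  obtain ⟨p, hp1, hp2, hp3⟩ := exists_proj F hF.1 _ (LinearMap.range f) rfl
  obtain ⟨g, hg⟩ := exists_pinv f
  refine ⟨insert ⊥ (Submodule.comap f '' F), ⟨?_, ?_, ?_⟩, ?_⟩
  · refine IsChain.insert ?_ (fun _ _ _ => Or.inl bot_le)
    rintro _ ⟨S, hS, rfl⟩ _ ⟨T, hT, rfl⟩ _
    rcases hF.1.total hS hT with h | h
    · exact Or.inl (Submodule.comap_mono h)
    · exact Or.inr (Submodule.comap_mono h)
  · exact Or.inl rfl
  · exact Or.inr ⟨⊤, hF.2.2, by simp⟩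
  intro φ hφ hid
  have hφf : ∀ S ∈ F, ∀ x, f x ∈ S → f (φ x) ∈ S := fun S hS x hx =>
    hφ _ (Or.inr ⟨S, hS, rfl⟩) x hx
  have hpf : ∀ x, p (f x) = f x := fun x => hp3 _ ⟨x, rfl⟩
  have hgf : ∀ x, f (φ (g (f x))) = f (φ x) := by
    intro x
    have := hφf ⊥ hF.2.1 (g (f x) - x) (by simp [hg])
    simpa [sub_eq_zero] using this
  refine ⟨f ∘ₗ φ ∘ₗ g ∘ₗ p, ?_, ?_, ?_⟩
  · intro S hS x hx
    obtain ⟨y, hy⟩ := hp2 x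
    have h1 := hp1 S hS x hx
    simp only [LinearMap.comp_apply]
    rw [← hy] at h1 ⊢
    rw [hgf]
    exact hφf S hS y h1
  · intro x
    simp only [LinearMap.comp_apply, hpf, hgf, hid]
  · intro x
    simp only [LinearMap.comp_apply, hpf, hgf]

end lin

section rep
variable {n : ℕ} {o : Fin n → Bool}

def Comm (L : ARep n o) (e : ∀ v, L.M v →ₗ[ℂ] L.M v) (i : Fin n) : Prop :=
  (e (ATgt o i)).comp (L.f i) = (L.f i).comp (e (ASrc o i))

theorem src_tgt (o : Fin n → Bool) (i : Fin n) :
    (o i = true ∧ ASrc o i = i.castSucc ∧ ATgt o i = i.succ) ∨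
    (o i = false ∧ ASrc o i = i.succ ∧ ATgt o i = i.castSucc) := by
  unfold ASrc ATgt
  cases h : o i <;> simp

theorem comm_congr (L : ARep n o) {e e' : ∀ v, L.M v →ₗ[ℂ] L.M v} {i : Fin n}
    (h1 : e i.castSucc = e' i.castSucc) (h2 : e i.succ = e' i.succ) (h : Comm L e i) :
    Comm L e' i := by
  unfold Comm at *
  have : e (ASrc o i) = e' (ASrc o i) ∧ e (ATgt o i) = e' (ATgt o i) := by
    rcases src_tgt o i with ⟨_, hs, ht⟩ | ⟨_, hs, ht⟩ <;> rw [hs, ht] <;> exact ⟨by assumption, by assumption⟩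
  rw [← this.1, ← this.2, h]

theorem step (L : ARep n o) (i : Fin n) (p q : Fin (n + 1))
    (hpq : (p = ASrc o i ∧ q = ATgt o i) ∨ (p = ATgt o i ∧ q = ASrc o i))
    (F : Set (Submodule ℂ (L.M p))) (hF : Good F) :
    ∃ G : Set (Submodule ℂ (L.M q)), Good G ∧ ∀ φ : L.M q →ₗ[ℂ] L.M q, Pres G φ →
      (∀ x, φ (φ x) = φ x) → ∃ ψ : L.M p →ₗ[ℂ] L.M p, Pres F ψ ∧ (∀ x, ψ (ψ x) = ψ x) ∧
        ∀ e : ∀ v, L.M v →ₗ[ℂ] L.M v, e p = ψ → e q = φ → Comm L e i := by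
  rcases hpq with ⟨rfl, rfl⟩ | ⟨rfl, rfl⟩
  · obtain ⟨G, hG, h⟩ := step_fwd (L.f i) F hF
    refine ⟨G, hG, fun φ h1 h2 => ?_⟩
    obtain ⟨ψ, a, b, c⟩ := h φ h1 h2
    refine ⟨ψ, a, b, fun e h3 h4 => ?_⟩
    unfold Comm
    rw [h3, h4]
    exact LinearMap.ext c
  · obtain ⟨G, hG, h⟩ := step_bwd (L.f i) F hF
    refine ⟨G, hG, fun φ h1 h2 => ?_⟩
    obtain ⟨ψ, a, b, c⟩ := h φ h1 h2
    refine ⟨ψ, a, b, fun e h3 h4 => ?_⟩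
    unfold Comm
    rw [h3, h4]
    exact LinearMap.ext c

theorem good_triv (V : Type) [AddCommGroup V] [Module ℂ V] [FiniteDimensional ℂ V] :
    Good ({⊥, ⊤} : Set (Submodule ℂ V)) := by
  refine ⟨?_, by simp, by simp⟩
  rintro _ (rfl | rfl) _ (rfl | rfl) _ <;> simp

theorem left_ext (L : ARep n o) (k : Fin (n + 1)) :
    ∃ G : Set (Submodule ℂ (L.M k)), Good G ∧ ∀ φ : L.M k →ₗ[ℂ] L.M k, Pres G φ →
      (∀ x, φ (φ x) = φ x) → ∃ e : ∀ v, L.M v →ₗ[ℂ] L.M v, e k = φ ∧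
        (∀ v ≤ k, ∀ x, e v (e v x) = e v x) ∧ ∀ j : Fin n, j.castSucc < k → Comm L e j := by
  induction k using Fin.induction with
  | zero =>
    refine ⟨{⊥, ⊤}, good_triv _, fun φ _ h2 => ⟨Function.update (fun _ => 0) 0 φ, by simp, ?_, ?_⟩⟩
    · intro v hv x
      have : v = 0 := by simpa using hv
      subst this
      simp [h2]
    · intro j hj
      exact absurd hj (by simp)
  | succ i ih =>
    obtain ⟨F, hF, hE⟩ := ih
    obtain ⟨G, hG, hS⟩ := step L i i.castSucc i.succ (by
      rcases src_tgt o i with ⟨_, h, h'⟩ | ⟨_, h, h'⟩ <;> simp [h, h']) F hF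
    refine ⟨G, hG, fun φ h1 h2 => ?_⟩
    obtain ⟨ψ, a, b, c⟩ := hS φ h1 h2
    obtain ⟨e, he, hid, hc⟩ := hE ψ a b
    have hne : ∀ v : Fin (n + 1), v ≤ i.castSucc → Function.update e i.succ φ v = e v := by
      intro v hv
      exact Function.update_of_ne (by rintro rfl; simp [Fin.le_def] at hv) _ _
    refine ⟨Function.update e i.succ φ, by simp, ?_, ?_⟩
    · intro v hv x
      by_cases hvi : v = i.succ
      · subst hvi; simp [h2]
      · have : v ≤ i.castSucc := by
          simp only [Fin.le_def, Fin.ext_iff, Fin.val_succ, Fin.val_castSucc] at *; omega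
        rw [hne v this]; exact hid v this x
    · intro j hj
      by_cases hji : j = i
      · subst hji
        exact c _ (by rw [hne _ le_rfl, he]) (by simp)
      · have : j.castSucc < i.castSucc := by
          simp only [Fin.lt_def, Fin.ext_iff, Fin.val_succ, Fin.val_castSucc] at *; omega
        refine comm_congr L (hne _ this.le).symm (hne _ ?_).symm (hc j this)
        simp only [Fin.le_def, Fin.lt_def, Fin.val_succ, Fin.val_castSucc] at *; omega

theorem right_ext (L : ARep n o) (k : Fin (n + 1)) :
    ∃ G : Set (Submodule ℂ (L.M k)), Good G ∧ ∀ φ : L.M k →ₗ[ℂ] L.M k, Pres G φ →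
      (∀ x, φ (φ x) = φ x) → ∃ e : ∀ v, L.M v →ₗ[ℂ] L.M v, e k = φ ∧
        (∀ v, k ≤ v → ∀ x, e v (e v x) = e v x) ∧ ∀ j : Fin n, k ≤ j.castSucc → Comm L e j := by
  induction k using Fin.reverseInduction with
  | last =>
    refine ⟨{⊥, ⊤}, good_triv _,
      fun φ _ h2 => ⟨Function.update (fun _ => 0) (Fin.last n) φ, by simp, ?_, ?_⟩⟩
    · intro v hv x
      have : v = Fin.last n := by simpa using hv
      subst this
      simp [h2]
    · intro j hj
      simp only [Fin.le_def, Fin.val_last, Fin.val_castSucc] at hj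
      omega
  | cast i ih =>
    obtain ⟨F, hF, hE⟩ := ih
    obtain ⟨G, hG, hS⟩ := step L i i.succ i.castSucc (by
      rcases src_tgt o i with ⟨_, h, h'⟩ | ⟨_, h, h'⟩ <;> simp [h, h']) F hF
    refine ⟨G, hG, fun φ h1 h2 => ?_⟩
    obtain ⟨ψ, a, b, c⟩ := hS φ h1 h2
    obtain ⟨e, he, hid, hc⟩ := hE ψ a b
    have hne : ∀ v : Fin (n + 1), i.succ ≤ v → Function.update e i.castSucc φ v = e v := by
      intro v hv
      exact Function.update_of_ne (by rintro rfl; simp [Fin.le_def] at hv) _ _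
    refine ⟨Function.update e i.castSucc φ, by simp, ?_, ?_⟩
    · intro v hv x
      by_cases hvi : v = i.castSucc
      · subst hvi; simp [h2]
      · have : i.succ ≤ v := by
          simp only [Fin.le_def, Fin.ext_iff, Fin.val_succ, Fin.val_castSucc] at *; omega
        rw [hne v this]; exact hid v this x
    · intro j hj
      by_cases hji : j = i
      · subst hji
        exact c _ (by rw [hne _ le_rfl, he]) (by simp)
      · have : i.succ ≤ j.castSucc := by
          simp only [Fin.le_def, Fin.ext_iff, Fin.val_succ, Fin.val_castSucc] at *; omega
        refine comm_congr L (hne _ this).symm (hne _ ?_).symm (hc j this)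
        simp only [Fin.le_def, Fin.val_succ, Fin.val_castSucc] at *; omega

/-- Indecomposable representations of type `A` are thin. -/
theorem thin (L : ARep n o) (hL : L.Indecomposable) (k : Fin (n + 1)) (x y : L.M k)
    (hx : x ≠ 0) : ∃ c : ℂ, y = c • x := by
  obtain ⟨F, hF, hFe⟩ := left_ext L k
  obtain ⟨G, hG, hGe⟩ := right_ext L k
  -- the smallest nonzero element of `G`
  have htop : (⊤ : Submodule ℂ (L.M k)) ≠ ⊥ := by
    intro h
    have : x ∈ (⊤ : Submodule ℂ (L.M k)) := trivial
    rw [h] at this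
    exact hx (by simpa using this)
  obtain ⟨R, ⟨hRG, hR⟩, hmin⟩ := (wellFounded_lt (α := Submodule ℂ (L.M k))).has_min
    {S | S ∈ G ∧ S ≠ ⊥} ⟨⊤, hG.2.2, htop⟩
  obtain ⟨z, hzR, l, hlz, hS⟩ := exists_rankone F hF.1 R hR
  have hid : ∀ w, (l.smulRight z) ((l.smulRight z) w) = (l.smulRight z) w := by
    intro w; simp [hlz]
  have hPF : Pres F (l.smulRight z) := by
    intro S hSF w hw
    simp only [LinearMap.smulRight_apply]
    rcases hS S hSF with h | h
    · exact S.smul_mem _ h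
    · simp [h w hw]
  have hPG : Pres G (l.smulRight z) := by
    intro S hSG w hw
    simp only [LinearMap.smulRight_apply]
    by_cases hb : S = ⊥
    · subst hb
      have : w = 0 := by simpa using hw
      simp [this]
    · refine S.smul_mem _ ?_
      rcases hG.1.total hRG hSG with h | h
      · exact h hzR
      · by_contra hn
        exact hmin S ⟨hSG, hb⟩ (lt_of_le_not_ge h (fun h' => hn (h' hzR)))
  obtain ⟨e1, h1, h1i, h1c⟩ := hFe _ hPF hid
  obtain ⟨e2, h2, h2i, h2c⟩ := hGe _ hPG hid
  let e : ∀ v, L.M v →ₗ[ℂ] L.M v := fun v => if v ≤ k then e1 v else e2 v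
  have hel : ∀ v, v ≤ k → e v = e1 v := fun v hv => if_pos hv
  have her : ∀ v, k ≤ v → e v = e2 v := by
    intro v hv
    by_cases h : v ≤ k
    · have : v = k := le_antisymm h hv
      subst this
      rw [hel v h, h1, h2]
    · exact if_neg h
  have hek : e k = l.smulRight z := by rw [hel k le_rfl, h1]
  have hcomm : e ∈ ARep.HomSub L L := by
    intro i
    change Comm L e i
    by_cases h : i.castSucc < k
    · refine comm_congr L (hel _ h.le).symm (hel _ ?_).symm (h1c i h)
      simp only [Fin.le_def, Fin.lt_def, Fin.val_succ, Fin.val_castSucc] at *; omega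
    · refine comm_congr L (her _ (not_lt.1 h)).symm (her _ ?_).symm (h2c i (not_lt.1 h))
      simp only [Fin.le_def, Fin.lt_def, Fin.val_succ, Fin.val_castSucc] at *; omega
  have hidem : ∀ v, (e v).comp (e v) = e v := by
    intro v
    ext w
    rw [LinearMap.comp_apply]
    rcases le_total v k with h | h
    · rw [hel v h]; exact h1i v h w
    · rw [her v h]; exact h2i v h w
  have hz0 : z ≠ 0 := by
    rintro rfl
    simp at hlz
  rcases hL.2 e hcomm hidem with h | h
  · exfalso
    have h3 : (l.smulRight z) z = 0 := by rw [← hek, h]; rfl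
    simp [hlz, hz0] at h3
  · have h3 : ∀ w, l w • z = w := by
      intro w
      have : (l.smulRight z) w = w := by rw [← hek, h]; rfl
      simpa using this
    have hlx : l x ≠ 0 := by
      intro h0
      exact hx (by rw [← h3 x, h0, zero_smul])
    refine ⟨l y * (l x)⁻¹, ?_⟩
    have h4 : (l y * (l x)⁻¹) • x = (l y * (l x)⁻¹) • (l x • z) := by rw [h3 x]
    rw [h4, smul_smul, mul_assoc, inv_mul_cancel₀ hlx, mul_one, h3]

theorem connected (L : ARep n o) (hL : L.Indecomposable) (i : Fin n) (hf : L.f i = 0) :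
    (∀ v, v ≤ i.castSucc → ∀ x : L.M v, x = 0) ∨ (∀ v, i.succ ≤ v → ∀ x : L.M v, x = 0) := by
  let e : ∀ v, L.M v →ₗ[ℂ] L.M v := fun v => if v ≤ i.castSucc then LinearMap.id else 0
  have hl : ∀ v, v ≤ i.castSucc → e v = LinearMap.id := fun v hv => if_pos hv
  have hr : ∀ v, i.succ ≤ v → e v = 0 := fun v hv => if_neg (by
    simp only [Fin.le_def, Fin.val_succ, Fin.val_castSucc] at *; omega)
  have hc : e ∈ ARep.HomSub L L := by
    intro j
    change Comm L e j
    rcases lt_trichotomy j i with h | h | h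
    · refine comm_congr L (e := fun _ => LinearMap.id) (hl _ ?_).symm (hl _ ?_).symm ?_
      · simp only [Fin.le_def, Fin.lt_def, Fin.val_succ, Fin.val_castSucc] at *; omega
      · simp only [Fin.le_def, Fin.lt_def, Fin.val_succ, Fin.val_castSucc] at *; omega
      · simp [Comm]
    · subst h
      simp [Comm, hf]
    · refine comm_congr L (e := fun _ => 0) (hr _ ?_).symm (hr _ ?_).symm ?_
      · simp only [Fin.le_def, Fin.lt_def, Fin.val_succ, Fin.val_castSucc] at *; omega
      · simp only [Fin.le_def, Fin.lt_def, Fin.val_succ, Fin.val_castSucc] at *; omega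
      · simp [Comm]
  have hi : ∀ v, (e v).comp (e v) = e v := by
    intro v
    by_cases h : v ≤ i.castSucc
    · rw [hl v h]; rfl
    · have : e v = 0 := if_neg h
      rw [this]; simp
  rcases hL.2 e hc hi with h | h
  · left
    intro v hv x
    have h1 := hl v hv
    rw [h] at h1
    exact (LinearMap.congr_fun h1 x).symm
  · right
    intro v hv x
    have h1 := hr v hv
    rw [h] at h1
    exact LinearMap.congr_fun h1 x

theorem surj (L : ARep n o) (hL : L.Indecomposable) (i : Fin n) (hf : L.f i ≠ 0)
    (y : L.M (ATgt o i)) : ∃ x, L.f i x = y := by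
  have : ∃ x, L.f i x ≠ 0 := by
    by_contra! h
    exact hf (LinearMap.ext h)
  obtain ⟨x, hx⟩ := this
  obtain ⟨c, hc⟩ := thin L hL _ _ y hx
  exact ⟨c • x, by rw [map_smul, hc]⟩

theorem src_rev (horient : ∀ i : Fin n, o i.rev = o i) (i : Fin n) :
    ASrc o i.rev = (ATgt o i).rev := by
  unfold ASrc ATgt
  rw [horient]
  cases h : o i <;> simp [Fin.rev_succ, Fin.rev_castSucc]

theorem tgt_rev (horient : ∀ i : Fin n, o i.rev = o i) (i : Fin n) :
    ATgt o i.rev = (ASrc o i).rev := by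
  unfold ASrc ATgt
  rw [horient]
  cases h : o i <;> simp [Fin.rev_succ, Fin.rev_castSucc]

/-- A form of the wrong symmetry vanishes. -/
theorem wrong_zero (horient : ∀ i : Fin n, o i.rev = o i)
    (L : ARep n o) (hL : L.Indecomposable)
    (D : (∀ v, L.M v) →ₗ[ℂ] (∀ v, L.M v) →ₗ[ℂ] ℂ)
    (hcompat : ∀ v w : Fin (n + 1), w ≠ v.rev → ∀ (x : L.M v) (y : L.M w),
      D (Pi.single v x) (Pi.single w y) = 0)
    (hmor : ∀ i : Fin n, ∀ (x : L.M (ASrc o i)) (y : L.M (ASrc o i.rev)),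
      D (Pi.single (ATgt o i) (L.f i x)) (Pi.single (ASrc o i.rev) y) +
        D (Pi.single (ASrc o i) x) (Pi.single (ATgt o i.rev) (L.f i.rev y)) = 0)
    (hsym : ∀ x y, D x y = -(-1) ^ n * D y x) : ∀ x y, D x y = 0 := by
  let P : Fin (n + 1) → Prop := fun v => ∀ w (x : L.M v) (y : L.M w),
    D (Pi.single v x) (Pi.single w y) = 0
  have hPrev : ∀ v, P v → P v.rev := by
    intro v hv w x y
    by_cases h : w = v
    · subst h
      rw [hsym, hv, mul_zero]
    · exact hcompat _ _ (by simpa using h) x y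
  have hPof : ∀ v w, w = v.rev → (∀ (x : L.M v) (y : L.M w),
      D (Pi.single v x) (Pi.single w y) = 0) → P v := by
    intro v w hw h w' x y
    by_cases h' : w' = v.rev
    · have : w' = w := by rw [hw, h']
      subst this
      exact h x y
    · exact hcompat _ _ h' x y
  have hD0 : ∀ v w (x : L.M v) (y : L.M w), (x = 0 ∨ y = 0) →
      D (Pi.single v x) (Pi.single w y) = 0 := by
    rintro v w x y (rfl | rfl) <;> simp
  -- center edge
  have hcen : ∀ i j : Fin n, j = i.rev → j = i → P i.succ := by
    intro i j hj hji
    have hnodd : Odd n := by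
      rw [hji, Fin.ext_iff, Fin.val_rev] at hj
      exact ⟨i, by omega⟩
    have hs : ∀ x y, D x y = D y x := by
      intro x y
      rw [hsym, hnodd.neg_one_pow]; simp
    have hm : ∀ (x y : L.M (ASrc o i)),
      D (Pi.single (ATgt o i) (L.f i x)) (Pi.single (ASrc o i) y) +
        D (Pi.single (ASrc o i) x) (Pi.single (ATgt o i) (L.f i y)) = 0 := by
      have := hmor i
      rw [← hj, hji] at this
      exact this
    have hm0 : ∀ x : L.M (ASrc o i),
        D (Pi.single (ATgt o i) (L.f i x)) (Pi.single (ASrc o i) x) = 0 := by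
      intro x
      have := hm x x
      rw [hs (Pi.single (ASrc o i) x)] at this
      have h2 : (2 : ℂ) * D (Pi.single (ATgt o i) (L.f i x)) (Pi.single (ASrc o i) x) = 0 := by
        rw [two_mul]; exact this
      simpa using h2
    have hir : i.rev = i := by rw [← hj, hji]
    have hsr := src_rev horient i
    rw [hir] at hsr
    have hPt : P (ATgt o i) := by
      refine hPof _ _ hsr ?_
      intro x y
      by_cases hf : L.f i = 0
      · apply hD0
        rcases connected L hL i hf with h | h <;> rcases src_tgt o i with ⟨_, h1, h2⟩ | ⟨_, h1, h2⟩
        · right; exact h _ h1.le y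
        · left; exact h _ h2.le x
        · left; exact h _ h2.ge x
        · right; exact h _ h1.ge y
      · by_cases hy : y = 0
        · exact hD0 _ _ _ _ (Or.inr hy)
        obtain ⟨x', rfl⟩ := surj L hL i hf x
        obtain ⟨c, rfl⟩ := thin L hL _ y x' hy
        have := hm0 y
        rw [map_smul, Pi.single_smul, map_smul, LinearMap.smul_apply, this, smul_zero]
    rcases src_tgt o i with ⟨_, h1, h2⟩ | ⟨_, h1, h2⟩
    · rw [← h2]; exact hPt
    · rw [← h1, hsr]; exact hPrev _ hPt
  have hstep : ∀ i : Fin n, n ≤ 2 * (i : ℕ) → P i.castSucc → P i.succ := by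
    intro i hi hP
    have hle : i.succ.rev ≤ i.castSucc := by
      simp only [Fin.le_def, Fin.val_rev, Fin.val_succ, Fin.val_castSucc]; omega
    rcases src_tgt o i with ⟨_, h1, h2⟩ | ⟨_, h1, h2⟩
    · have hPs : P (ASrc o i) := by rw [h1]; exact hP
      rw [← h2]
      rw [← h2] at hle
      refine hPof _ _ (src_rev horient i) fun x y => ?_
      by_cases hf : L.f i = 0
      · apply hD0
        rcases connected L hL i hf with h | h
        · right; exact h _ (by rw [src_rev horient i]; exact hle) y
        · left; exact h _ h2.ge x
      · obtain ⟨x', rfl⟩ := surj L hL i hf x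
        have := hmor i x' y
        rw [hPs, add_zero] at this
        exact this
    · have hPs : P (ATgt o i) := by rw [h2]; exact hP
      rw [← h1]
      refine hPof _ _ (tgt_rev horient i) fun x y => ?_
      by_cases hf : L.f i.rev = 0
      · apply hD0
        rcases connected L hL i.rev hf with h | h
        · right
          refine h _ ?_ y
          rw [tgt_rev horient i, h1]
          simp only [Fin.le_def, Fin.val_rev, Fin.val_succ, Fin.val_castSucc]; omega
        · left
          refine h _ ?_ x
          rw [h1]
          simp only [Fin.le_def, Fin.val_rev, Fin.val_succ]; omega
      · obtain ⟨y', rfl⟩ := surj L hL i.rev hf y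
        have := hmor i x y'
        rw [hPs, zero_add] at this
        exact this
  have hright : ∀ v : Fin (n + 1), n ≤ 2 * (v : ℕ) → P v := by
    intro v
    have hself : ∀ v : Fin (n + 1), n = 2 * (v : ℕ) → P v := by
      intro v hv
      have hvr : v = v.rev := by rw [Fin.ext_iff, Fin.val_rev]; omega
      refine hPof v v hvr fun x y => ?_
      by_cases hx : x = 0
      · exact hD0 _ _ _ _ (Or.inl hx)
      obtain ⟨c, rfl⟩ := thin L hL _ x y hx
      have h1 := hsym (Pi.single v x) (Pi.single v x)
      have he : Even n := ⟨v, by omega⟩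
      rw [he.neg_one_pow] at h1
      have h2 : (2 : ℂ) * D (Pi.single v x) (Pi.single v x) = 0 := by linear_combination h1
      have h3 : D (Pi.single v x) (Pi.single v x) = 0 := by simpa using h2
      rw [Pi.single_smul, map_smul, h3, smul_zero]
    induction v using Fin.induction with
    | zero => intro h; exact hself 0 (by simp at h ⊢; exact h)
    | succ i ih =>
      intro h
      simp only [Fin.val_succ] at h
      by_cases h1 : n = 2 * ((i : ℕ) + 1)
      · exact hself _ (by simpa using h1)
      by_cases h2 : n + 1 = 2 * ((i : ℕ) + 1)
      · refine hcen i i ?_ rfl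
        rw [Fin.ext_iff, Fin.val_rev]; omega
      · have h3 : n ≤ 2 * (i : ℕ) := by omega
        exact hstep i h3 (ih (by simpa using h3))
  have hall : ∀ v, P v := by
    intro v
    by_cases h : n ≤ 2 * (v : ℕ)
    · exact hright v h
    · have := hPrev _ (hright v.rev (by rw [Fin.val_rev]; omega))
      rwa [Fin.rev_rev] at this
  intro x y
  have h0 : D = 0 := by
    apply LinearMap.pi_ext
    intro v x
    apply LinearMap.pi_ext
    intro w y
    exact hall v w x y
  rw [h0]; rfl

theorem main_eq (horient : ∀ i : Fin n, o i.rev = o i)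
    (L : ARep n o) (hL : L.Indecomposable)
    (B : (∀ v, L.M v) →ₗ[ℂ] (∀ v, L.M v) →ₗ[ℂ] ℂ)
    (hcompat : ∀ v w : Fin (n + 1), w ≠ v.rev → ∀ (x : L.M v) (y : L.M w),
      B (Pi.single v x) (Pi.single w y) = 0)
    (hmor : ∀ i : Fin n, ∀ (x : L.M (ASrc o i)) (y : L.M (ASrc o i.rev)),
      B (Pi.single (ATgt o i) (L.f i x)) (Pi.single (ASrc o i.rev) y) +
        B (Pi.single (ASrc o i) x) (Pi.single (ATgt o i.rev) (L.f i.rev y)) = 0) :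
    ∀ x y, B x y = (-1) ^ n * B y x := by
  have hsq : ((-1 : ℂ) ^ n) * (-1) ^ n = 1 := by
    rw [← mul_pow]; simp
  have hmor' : ∀ i j : Fin n, i = j.rev → ∀ (x : L.M (ASrc o i)) (y : L.M (ASrc o j)),
      B (Pi.single (ATgt o i) (L.f i x)) (Pi.single (ASrc o j) y) +
        B (Pi.single (ASrc o i) x) (Pi.single (ATgt o j) (L.f j y)) = 0 := by
    intro i j hij
    have h : j = i.rev := by rw [hij, Fin.rev_rev]
    subst h
    exact hmor i
  have key := wrong_zero horient L hL (B - (-1 : ℂ) ^ n • B.flip) ?_ ?_ ?_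
  · intro x y
    have := key x y
    simp only [LinearMap.sub_apply, LinearMap.smul_apply, LinearMap.flip_apply, smul_eq_mul] at this
    linear_combination this
  · intro v w hw x y
    have hv : v ≠ w.rev := by
      rintro rfl
      exact hw (by simp)
    simp only [LinearMap.sub_apply, LinearMap.smul_apply, LinearMap.flip_apply, smul_eq_mul,
      hcompat v w hw, hcompat w v hv, mul_zero, sub_zero]
  · intro i x y
    simp only [LinearMap.sub_apply, LinearMap.smul_apply, LinearMap.flip_apply, smul_eq_mul]
    linear_combination hmor i x y - (-1) ^ n * hmor' i.rev i rfl y x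
  · intro x y
    simp only [LinearMap.sub_apply, LinearMap.smul_apply, LinearMap.flip_apply, smul_eq_mul]
    linear_combination (-B x y) * hsq

end rep

end ARepAux

open ARep in
/-- Let `Q` be a quiver of type `A_{n+1}` whose orientation is compatible
with the anti-involution `σ(v) = n - v` (`Fin.rev`); compatibility reads `o (i.rev) = o i`.
A morphism `f : L → ∇L` to the twisted dual is encoded, equivalently and without dependent
casts, by the bilinear form `B` on the total space `∀ v, L.M v` given by
`B x y = Σ_v f_v (x_v) (y_{σ v})`.  Under this dictionary:
* `B` is supported on pairs of components `(v, σ v)` (hypothesis `hcompat`);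
* `f` being a morphism `L → ∇L` reads
  `B (single (tgt i) (L.f i x)) (single (src i.rev) y)
     + B (single (src i) x) (single (tgt i.rev) (L.f i.rev y)) = 0`  (hypothesis `hmor`,
  the sign coming from `(∇L)_α = −(L_{σα})*`);
* `∇f = f` reads `B x y = B y x` and `∇f = −f` reads `B x y = −B y x`.

Claim: if the number `n+1` of vertices is odd then every such `B` is symmetric (`∇f = f`);
if `n+1` is even then every such `B` is antisymmetric (`∇f = −f`).  Consequently in the
split types (`ε = −1` for `n+1` odd, `ε = +1` for `n+1` even) the `ε∇`-eigenspace
`Hom(L,∇L)^{ε∇}` vanishes. -/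
theorem ARep.hom_to_twisted_dual_eigenvalue
    {n : ℕ} {o : Fin n → Bool}
    (horient : ∀ i : Fin n, o i.rev = o i)
    (L : ARep n o) (hL : L.Indecomposable)
    (B : (∀ v, L.M v) →ₗ[ℂ] (∀ v, L.M v) →ₗ[ℂ] ℂ)
    (hcompat : ∀ v w : Fin (n + 1), w ≠ v.rev → ∀ (x : L.M v) (y : L.M w),
      B (Pi.single v x) (Pi.single w y) = 0)
    (hmor : ∀ i : Fin n, ∀ (x : L.M (ASrc o i)) (y : L.M (ASrc o i.rev)),
      B (Pi.single (ATgt o i) (L.f i x)) (Pi.single (ASrc o i.rev) y) +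
        B (Pi.single (ASrc o i) x) (Pi.single (ATgt o i.rev) (L.f i.rev y)) = 0) :
    (Odd (n + 1) → ∀ x y, B x y = B y x) ∧
    (Even (n + 1) → ∀ x y, B x y = - B y x) ∧
    (Odd (n + 1) → (∀ x y, B x y = - B y x) → B = 0) ∧
    (Even (n + 1) → (∀ x y, B x y = B y x) → B = 0) := by
  have key := ARepAux.main_eq horient L hL B hcompat hmor
  have hodd : Odd (n + 1) → ∀ x y, B x y = B y x := by
    intro h x y
    have he : Even n := by
      rcases Nat.even_or_odd n with h' | h'
      · exact h'
      · exact absurd h'.add_one (Nat.not_even_iff_odd.2 h)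
    rw [key, he.neg_one_pow, one_mul]
  have heven : Even (n + 1) → ∀ x y, B x y = - B y x := by
    intro h x y
    have ho : Odd n := by
      rcases Nat.even_or_odd n with h' | h'
      · exact absurd h'.add_one (Nat.not_odd_iff_even.2 h)
      · exact h'
    rw [key, ho.neg_one_pow, neg_one_mul]
  have hz : (∀ x y, B x y = B y x) → (∀ x y, B x y = - B y x) → B = 0 := by
    intro h1 h2
    refine LinearMap.ext fun x => LinearMap.ext fun y => ?_
    have h3 : (2 : ℂ) * B x y = 0 := by linear_combination h1 x y + h2 x y
    simpa using h3
  exact ⟨hodd, heven, fun h h2 => hz (hodd h) h2, fun h h2 => hz h2 (heven h)⟩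
end
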